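/- Let G = ℝ^{n+1} be a Grushin space of homogeneous dimension Q = n+2 with Q ≥ 4, let B_R^Q(o) be the gauge ball of radius R > 0, and let 1 < p < Q. Then for any u ∈ C_0^∞(B_R^Q(o)): ∫_{B_R^Q(o)} |L_{ϱ,G} u|^p / (ψ^{p/2} ϱ^{Q−2p}) dx dt ≥ ((Q−2)(p−1)/p)^p ∫_{B_R^Q(o)} |u|^p ψ^{p/2} / (ϱ^{Q} (ln(R/ϱ))^{p}) dx dt, and the constant ((Q−2)(p−1)/p)^p is best possible. -/

import Mathlib

open MeasureTheory Real

noncomputable section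

/-- Points of the Grushin space `ℝ^{n+1}`. -/
abbrev GPt (n : ℕ) := EuclideanSpace ℝ (Fin n) × ℝ

/-- Homogeneous Grushin norm `ϱ(x,t) = (|x|⁴ + 4t²)^{1/4}`. -/
def gNorm {n : ℕ} (z : GPt n) : ℝ := (‖z.1‖ ^ 4 + 4 * z.2 ^ 2) ^ ((1 : ℝ) / 4)

/-- The geometric term `ψ(x,t) = |x|²/ϱ²` (so that `|∇_G ϱ| = ψ^{1/2}`). -/
def gPsi {n : ℕ} (z : GPt n) : ℝ := ‖z.1‖ ^ 2 / gNorm z ^ 2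

/-- Radial derivative `∂_ϱ u(x,t) = d/ds u(s·x/ϱ, s²·t/ϱ²)` at `s = ϱ(x,t)`. -/
def radialDeriv {n : ℕ} (u : GPt n → ℝ) (z : GPt n) : ℝ :=
  deriv (fun s : ℝ => u ((s / gNorm z) • z.1, (s ^ 2 / gNorm z ^ 2) * z.2)) (gNorm z)

/-- The scaled function `u_R(x,t) = u(R·x/ϱ, R²·t/ϱ²)`. -/
def uScaled {n : ℕ} (R : ℝ) (u : GPt n → ℝ) (z : GPt n) : ℝ :=
  u ((R / gNorm z) • z.1, (R ^ 2 / gNorm z ^ 2) * z.2)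

/-- Radial Grushin operator `L_{ϱ,G} u = ψ(∂_ϱ² u + ((Q−1)/ϱ) ∂_ϱ u)`. -/
def radialLap {n : ℕ} (Q : ℝ) (u : GPt n → ℝ) (z : GPt n) : ℝ :=
  gPsi z * (radialDeriv (radialDeriv u) z + (Q - 1) / gNorm z * radialDeriv u z)

/-- The Grushin operator `L_G u = Δ_x u + |x|² ∂_t² u`. -/
def grushinOp {n : ℕ} (u : GPt n → ℝ) (z : GPt n) : ℝ :=
  (∑ i : Fin n,
      deriv (deriv fun s : ℝ => u (z.1 + s • EuclideanSpace.single i (1 : ℝ), z.2)) 0)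
    + ‖z.1‖ ^ 2 * deriv (deriv fun s : ℝ => u (z.1, z.2 + s)) 0

/-- The first-order operator `T_β(u) = ψ^{1/2}(∂_ϱ u + ((Q−β−2)/(2ϱ)) u)`. -/
def Tweight {n : ℕ} (Q β : ℝ) (u : GPt n → ℝ) (z : GPt n) : ℝ :=
  Real.sqrt (gPsi z) * (radialDeriv u z + (Q - β - 2) / (2 * gNorm z) * u z)

/-- The iterated operator `R_{β,k} = T_β ∘ T_{β+2} ∘ ⋯ ∘ T_{β+2k}`. -/
def Rop {n : ℕ} (Q : ℝ) : ℕ → ℝ → (GPt n → ℝ) → GPt n → ℝ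
  | 0, β, u => Tweight Q β u
  | k + 1, β, u => Tweight Q β (Rop Q k (β + 2) u)

/-- The constants `Λ_k(Q,p,β)`. -/
def Lam (Q p β : ℝ) (k : ℕ) : ℝ :=
  if k = 1 then ((Q - p - β) / p) ^ p
  else ((Q * (p - 1) + β + ((k : ℝ) - 2) * p) * (Q - β - (k : ℝ) * p) / p ^ 2) ^ p

/-- The constant `C_{2l,p,β} = ∏_{i=1}^{l} Λ_{2i}(Q,p,β)`. -/
def Ceven (Q p β : ℝ) (l : ℕ) : ℝ := ∏ i ∈ Finset.range l, Lam Q p β (2 * i + 2)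

/-- The constant `C_{2l+1,p,β} = ∏_{i=0}^{l} Λ_{2i+1}(Q,p,β)`. -/
def Codd (Q p β : ℝ) (l : ℕ) : ℝ := ∏ i ∈ Finset.range (l + 1), Lam Q p β (2 * i + 1)

/-- The constant `A_m = ((Q+m)² + (Q−4−m)²)/4`. -/
def Aconst (Q m : ℝ) : ℝ := ((Q + m) ^ 2 + (Q - 4 - m) ^ 2) / 4

/-- The constants `D_{j,m,β}` given by the iteration
`D_{j,m+1,β} = Λ_{2m+2}(Q,2,β) D_{j−2,m,β} + A_{β+4m} D_{j−1,m,β} + D_{j,m,β}`,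
with `D_{0,0,β} = 1` (and vanishing off-range values). -/
def Dconst (Q β : ℝ) : ℕ → ℤ → ℝ
  | 0, j => if j = 0 then 1 else 0
  | m + 1, j =>
      Lam Q 2 β (2 * m + 2) * Dconst Q β m (j - 2)
        + Aconst Q (β + 4 * (m : ℝ)) * Dconst Q β m (j - 1) + Dconst Q β m j

/-- The constants `B_{j,m,β,k}` given by the iteration
`B_{j,m+1,β,k} = Λ_2(Q,2,β+2k+2) B_{j−2,m,β+4,k} + A_{β+2k+2} B_{j−1,m,β+2,k+1} + B_{j,m,β,k+2}`,
with `B_{0,0,β,k} = 1` (and vanishing off-range values). -/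
def Bconst (Q : ℝ) : ℕ → ℤ → ℝ → ℝ → ℝ
  | 0, j, _, _ => if j = 0 then 1 else 0
  | m + 1, j, β, k =>
      Lam Q 2 (β + 2 * k + 2) 2 * Bconst Q m (j - 2) (β + 4) k
        + Aconst Q (β + 2 * k + 2) * Bconst Q m (j - 1) (β + 2) (k + 1)
        + Bconst Q m j β (k + 2)

/-- Surface measure `ω_n` of the unit sphere in `ℝ^n`. -/
def sphSurface (n : ℕ) : ℝ :=
  n * (volume (Metric.ball (0 : EuclideanSpace ℝ (Fin n)) 1)).toReal

/-- The integral constant `C^{Ω,m} = ω_n ∫_0^π (sin φ)^{(n+m)/2} dφ`. -/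
def COmega (n m : ℕ) : ℝ :=
  sphSurface n * ∫ φ in (0 : ℝ)..π, Real.sin φ ^ (((n : ℝ) + (m : ℝ)) / 2)

/-- The sharp Frank–Seiringer constant `c_p = min_{0<t≤1/2} [(1−t)^p − t^p + p t^{p−1}]`. -/
def cFS (p : ℝ) : ℝ :=
  sInf {y : ℝ | ∃ t : ℝ, 0 < t ∧ t ≤ 1 / 2 ∧ y = (1 - t) ^ p - t ^ p + p * t ^ (p - 1)}

/-- Compactly supported smooth test functions with (closed) support inside `s`. -/
def IsTest {n : ℕ} (s : Set (GPt n)) (u : GPt n → ℝ) : Prop :=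
  ContDiff ℝ (⊤ : ℕ∞) u ∧ HasCompactSupport u ∧ tsupport u ⊆ s

/-- A function on the Grushin space is radial if it depends only on the homogeneous norm. -/
def IsRadial {n : ℕ} (u : GPt n → ℝ) : Prop :=
  ∃ f : ℝ → ℝ, ∀ z, u z = f (gNorm z)

/-- The distance function `d_H(u,R)`. -/
def dH {n : ℕ} (Q p β R : ℝ) (u : GPt n → ℝ) : ℝ :=
  (∫ z : GPt n,
      |u z - R ^ ((Q - p - β) / p) * uScaled R u z * gNorm z ^ (-((Q - p - β) / p))| ^ p *
        gPsi z ^ (p / 2) / (|Real.log (R / gNorm z)| ^ p * gNorm z ^ (p + β))) ^ (1 / p)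

/-- The distance function `d_R(u,k,β)`. -/
def dRdist {n : ℕ} (Q p β R : ℝ) (k : ℕ) (u : GPt n → ℝ) : ℝ :=
  (∫ z : GPt n,
      (|u z| ^ ((p - 2) / 2) * u z -
          |uScaled R u z| ^ ((p - 2) / 2) * uScaled R u z *
            (gNorm z / R) ^ (-((Q - (k : ℝ) * p - β) / 2))) ^ 2 *
        gPsi z ^ (p / 2) /
        (gNorm z ^ ((k : ℝ) * p + β) * Real.log (R / gNorm z) ^ 2)) ^ ((1 : ℝ) / 2)

/-- The distance function `d_C(u,R)`. -/
def dCdist {n : ℕ} (Q p R : ℝ) (u : GPt n → ℝ) : ℝ :=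
  (∫ z in {z : GPt n | gNorm z < 1},
      |u z - Real.log (1 / gNorm z) ^ ((p - 1) / p) * R ^ ((p - 1) / p) *
          uScaled (Real.exp (-1 / R)) u z| ^ p *
        gPsi z ^ (p / 2) /
        (gNorm z ^ Q * Real.log (1 / gNorm z) ^ p *
          |Real.log (R * Real.log (1 / gNorm z))| ^ p)) ^ (1 / p)

/-- The anisotropic dilation `(x, t) ↦ (s x, s² t)`. -/
def dil {n : ℕ} (s : ℝ) (z : GPt n) : GPt n := (s • z.1, s ^ 2 * z.2)

/-- The generator `x · ∂ₓ + 2 t ∂ₜ` of the dilations. -/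
def eul {n : ℕ} (u : GPt n → ℝ) (z : GPt n) : ℝ := fderiv ℝ u z (z.1, 2 * z.2)

section Geometry

variable {n : ℕ}

lemma gNorm_nonneg (z : GPt n) : 0 ≤ gNorm z := by unfold gNorm; positivity

lemma gNorm_pow_four (z : GPt n) : gNorm z ^ 4 = ‖z.1‖ ^ 4 + 4 * z.2 ^ 2 := by
  unfold gNorm
  rw [← Real.rpow_natCast, ← Real.rpow_mul (by positivity)]
  norm_num

lemma gNorm_zero : gNorm (0 : GPt n) = 0 := by
  have h := gNorm_pow_four (0 : GPt n)
  simpa using h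

lemma gNorm_eq_zero_iff {z : GPt n} : gNorm z = 0 ↔ z = 0 := by
  refine ⟨fun h => ?_, fun h => h ▸ gNorm_zero⟩
  have h4 := gNorm_pow_four z
  rw [h] at h4
  have h1 : ‖z.1‖ ^ 4 = 0 := by nlinarith [sq_nonneg z.2, sq_nonneg (‖z.1‖ ^ 2)]
  have h2 : z.2 ^ 2 = 0 := by nlinarith [sq_nonneg z.2, sq_nonneg (‖z.1‖ ^ 2)]
  exact Prod.ext (by simpa using h1) (by simpa using h2)

lemma gNorm_pos {z : GPt n} (hz : z ≠ 0) : 0 < gNorm z :=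
  (gNorm_nonneg z).lt_of_ne fun h => hz (gNorm_eq_zero_iff.1 h.symm)

lemma continuous_gNorm : Continuous (gNorm : GPt n → ℝ) := by
  unfold gNorm
  exact Continuous.rpow_const (by fun_prop) fun _ => Or.inr (by norm_num)

lemma norm_fst_le_gNorm (z : GPt n) : ‖z.1‖ ≤ gNorm z := by
  refine le_of_pow_le_pow_left₀ (n := 4) (by norm_num) (gNorm_nonneg z) ?_
  rw [gNorm_pow_four]
  nlinarith [sq_nonneg z.2]

lemma two_mul_abs_snd_le_gNorm_sq (z : GPt n) : 2 * |z.2| ≤ gNorm z ^ 2 := by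
  refine le_of_pow_le_pow_left₀ (n := 2) (by norm_num) (by positivity) ?_
  rw [← pow_mul, gNorm_pow_four, mul_pow, sq_abs]
  nlinarith [sq_nonneg (‖z.1‖ ^ 2)]

lemma gPsi_nonneg (z : GPt n) : 0 ≤ gPsi z := by unfold gPsi; positivity

lemma gPsi_le_one (z : GPt n) : gPsi z ≤ 1 := by
  unfold gPsi
  exact div_le_one_of_le₀ (pow_le_pow_left₀ (norm_nonneg _) (norm_fst_le_gNorm z) 2) (by positivity)

lemma gPsi_zero : gPsi (0 : GPt n) = 0 := by simp [gPsi]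

lemma measurable_gPsi : Measurable (gPsi : GPt n → ℝ) := by
  unfold gPsi
  exact (measurable_fst.norm.pow_const 2).div (continuous_gNorm.measurable.pow_const 2)

lemma gNorm_dil {s : ℝ} (hs : 0 ≤ s) (z : GPt n) : gNorm (dil s z) = s * gNorm z := by
  refine (pow_left_inj₀ (gNorm_nonneg _) (mul_nonneg hs (gNorm_nonneg z)) (n := 4) (by norm_num)).1 ?_
  rw [gNorm_pow_four, mul_pow, gNorm_pow_four]
  simp only [dil, norm_smul, Real.norm_eq_abs, abs_of_nonneg hs]
  ring

lemma gPsi_dil {s : ℝ} (hs : 0 < s) (z : GPt n) : gPsi (dil s z) = gPsi z := by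
  unfold gPsi
  rw [gNorm_dil hs.le]
  simp only [dil, norm_smul, Real.norm_eq_abs, abs_of_pos hs, mul_pow]
  rw [mul_div_mul_left _ _ (by positivity)]

lemma dil_dil (s r : ℝ) (z : GPt n) : dil s (dil r z) = dil (s * r) z := by
  simp only [dil, smul_smul]
  congr 1
  ring

lemma dil_one (z : GPt n) : dil 1 z = z := by simp [dil]

lemma continuous_dil : Continuous fun q : ℝ × GPt n => dil q.1 q.2 := by
  unfold dil
  fun_prop

lemma dil_zero_left (z : GPt n) : dil 0 z = 0 := by simp [dil]

lemma measurable_dil_exp : Measurable fun q : ℝ × GPt n => dil (Real.exp q.1) q.2 :=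
  (continuous_dil.comp ((Real.continuous_exp.comp continuous_fst).prodMk continuous_snd)).measurable

lemma contDiff_eul {u : GPt n → ℝ} (hu : ContDiff ℝ (⊤ : ℕ∞) u) :
    ContDiff ℝ (⊤ : ℕ∞) (eul u) := by
  unfold eul
  exact (hu.fderiv_right (m := (⊤ : ℕ∞)) (by simp)).clm_apply (by fun_prop)

lemma support_eul_subset (u : GPt n → ℝ) : Function.support (eul u) ⊆ tsupport u := by
  intro z hz
  refine support_fderiv_subset ℝ fun h => hz ?_
  simp [eul, h]

lemma isTest_eul {s : Set (GPt n)} {u : GPt n → ℝ} (hu : IsTest s u) : IsTest s (eul u) :=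
  ⟨contDiff_eul hu.1, hu.2.1.mono' (support_eul_subset u),
    (closure_minimal (support_eul_subset u) (isClosed_tsupport u)).trans hu.2.2⟩

lemma eul_zero (u : GPt n → ℝ) : eul u 0 = 0 := by
  have h : (((0 : GPt n).1, 2 * (0 : GPt n).2) : GPt n) = 0 := by simp
  unfold eul
  rw [h, map_zero]

lemma hasDerivAt_comp_dil {u : GPt n → ℝ} (hu : Differentiable ℝ u) (z : GPt n) {s : ℝ}
    (hs : s ≠ 0) :
    HasDerivAt (fun r : ℝ => u (dil r z)) (eul u (dil s z) / s) s := by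
  have h1 : HasDerivAt (fun r : ℝ => dil r z) (z.1, 2 * s * z.2) s := by
    have := (hasDerivAt_id s).smul_const z.1
    have h2 := ((hasDerivAt_id s).pow 2).mul_const z.2
    simpa [dil] using this.prodMk h2
  have h3 := (hu (dil s z)).hasFDerivAt.comp_hasDerivAt s h1
  refine h3.congr_deriv ?_
  unfold eul
  have hsmul := (fderiv ℝ u (dil s z)).map_smul s⁻¹ ((dil s z).1, 2 * (dil s z).2)
  rw [smul_eq_mul] at hsmul
  rw [div_eq_inv_mul, ← hsmul]
  congr 1
  simp only [dil, Prod.smul_mk, smul_smul, smul_eq_mul, inv_mul_cancel₀ hs, one_smul]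
  congr 1
  field_simp

lemma hasDerivAt_comp_dil_exp_neg {u : GPt n → ℝ} (hu : Differentiable ℝ u) (z : GPt n) (τ : ℝ) :
    HasDerivAt (fun r : ℝ => u (dil (Real.exp (-r)) z)) (-eul u (dil (Real.exp (-τ)) z)) τ := by
  have h := (hasDerivAt_comp_dil hu z (Real.exp_pos (-τ)).ne').comp τ
    ((Real.hasDerivAt_exp (-τ)).comp τ (hasDerivAt_neg τ))
  refine h.congr_deriv ?_
  have := (Real.exp_pos (-τ)).ne'
  field_simp

lemma radialDeriv_eq {u : GPt n → ℝ} {z : GPt n} (hz : z ≠ 0)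
    {d : ℝ} (hd : HasDerivAt (fun r : ℝ => u (dil r z)) d 1) :
    radialDeriv u z = d / gNorm z := by
  have hg := gNorm_pos hz
  have h1 : HasDerivAt (fun s : ℝ => s / gNorm z) (1 / gNorm z) (gNorm z) :=
    (hasDerivAt_id _).div_const _
  have h2 : HasDerivAt (fun r : ℝ => u (dil r z)) d (gNorm z / gNorm z) := by
    rwa [div_self hg.ne']
  have h3 := (HasDerivAt.comp (h := fun s : ℝ => s / gNorm z) (gNorm z) h2 h1).deriv
  unfold radialDeriv
  rw [← mul_one_div, ← h3]
  congr 1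
  ext s
  simp [dil, div_pow]

lemma radialDeriv_eq_eul {u : GPt n → ℝ} (hu : Differentiable ℝ u) {z : GPt n} (hz : z ≠ 0) :
    radialDeriv u z = eul u z / gNorm z := by
  refine radialDeriv_eq hz ?_
  simpa [dil_one] using hasDerivAt_comp_dil hu z one_ne_zero

lemma dil_ne_zero {s : ℝ} (hs : 0 < s) {z : GPt n} (hz : z ≠ 0) : dil s z ≠ 0 := by
  intro h
  have := gNorm_dil hs.le z
  rw [h, gNorm_zero] at this
  exact (mul_pos hs (gNorm_pos hz)).ne this

lemma radialDeriv_radialDeriv {u : GPt n → ℝ} (hu : ContDiff ℝ (⊤ : ℕ∞) u) {z : GPt n}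
    (hz : z ≠ 0) :
    radialDeriv (radialDeriv u) z = (eul (eul u) z - eul u z) / gNorm z ^ 2 := by
  have hg := gNorm_pos hz
  have hd : Differentiable ℝ u := hu.differentiable (by simp)
  have hd' : Differentiable ℝ (eul u) := (contDiff_eul hu).differentiable (by simp)
  have key : HasDerivAt (fun r : ℝ => radialDeriv u (dil r z))
      ((eul (eul u) z - eul u z) / gNorm z) 1 := by
    have h1 := hasDerivAt_comp_dil hd' z one_ne_zero
    have h2 : HasDerivAt (fun r : ℝ => r * gNorm z) (gNorm z) 1 := by
      simpa using (hasDerivAt_id (1 : ℝ)).mul_const (gNorm z)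
    have h3 := h1.div h2 (by simpa using hg.ne')
    have h4 : HasDerivAt (fun r : ℝ => eul u (dil r z) / (r * gNorm z))
        ((eul (eul u) z - eul u z) / gNorm z) 1 := by
      refine h3.congr_deriv ?_
      simp only [dil_one]
      field_simp
    refine h4.congr_of_eventuallyEq ?_
    filter_upwards [lt_mem_nhds (zero_lt_one' ℝ)] with r hr
    rw [radialDeriv_eq_eul hd (dil_ne_zero hr hz), gNorm_dil hr.le]
  rw [radialDeriv_eq hz key]
  field_simp

/-- `ϱ² ψ⁻¹ L_{ϱ,G} u` written with the generator of the dilations. -/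
lemma radialLap_eq (Q : ℝ) {u : GPt n → ℝ} (hu : ContDiff ℝ (⊤ : ℕ∞) u) {z : GPt n}
    (hz : z ≠ 0) :
    radialLap Q u z = gPsi z * ((eul (eul u) z + (Q - 2) * eul u z) / gNorm z ^ 2) := by
  have hg := gNorm_pos hz
  unfold radialLap
  rw [radialDeriv_radialDeriv hu hz, radialDeriv_eq_eul (hu.differentiable (by simp)) hz]
  field_simp
  ring

lemma rellich_integrand_eq {Q p : ℝ} (hp : 1 < p) {u : GPt n → ℝ} (hu : ContDiff ℝ (⊤ : ℕ∞) u)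
    (z : GPt n) :
    |radialLap Q u z| ^ p / (gPsi z ^ (p / 2) * gNorm z ^ (Q - 2 * p)) =
      gNorm z ^ (-Q) * gPsi z ^ (p / 2) * |eul (eul u) z + (Q - 2) * eul u z| ^ p := by
  by_cases hψ : gPsi z = 0
  · simp [radialLap, hψ, Real.zero_rpow (by linarith : p ≠ 0),
      Real.zero_rpow (by linarith : p / 2 ≠ 0)]
  have hz : z ≠ 0 := fun h => hψ (h ▸ gPsi_zero)
  have hg := gNorm_pos hz
  have hψ' : 0 < gPsi z := (gPsi_nonneg z).lt_of_ne (Ne.symm hψ)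
  rw [radialLap_eq Q hu hz, abs_mul, abs_of_pos hψ', abs_div, abs_of_pos (pow_pos hg 2),
    Real.mul_rpow hψ'.le (by positivity), Real.div_rpow (abs_nonneg _) (by positivity),
    Real.rpow_sub hg, Real.rpow_neg hg.le]
  have e1 : gPsi z ^ p = gPsi z ^ (p / 2) * gPsi z ^ (p / 2) := by
    rw [← Real.rpow_add hψ']; ring_nf
  have e2 : (gNorm z ^ 2) ^ p = gNorm z ^ (2 * p) := by
    rw [Real.rpow_mul hg.le]; norm_num
  rw [e1, e2]
  have := Real.rpow_pos_of_pos hg Q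
  have := Real.rpow_pos_of_pos hg (2 * p)
  have := Real.rpow_pos_of_pos hψ' (p / 2)
  field_simp

end Geometry

section Polar

variable {n : ℕ}

/-- A fundamental domain for the action of the dilations. -/
def gShell (n : ℕ) : Set (GPt n) := {z | 1 ≤ gNorm z ∧ gNorm z < Real.exp 1}

lemma measurableSet_gShell : MeasurableSet (gShell n) :=
  (measurableSet_le measurable_const continuous_gNorm.measurable).inter
    (measurableSet_lt continuous_gNorm.measurable measurable_const)

lemma ne_zero_of_mem_gShell {z : GPt n} (hz : z ∈ gShell n) : z ≠ 0 := by
  rintro rfl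
  have := hz.1
  rw [gNorm_zero] at this
  linarith

lemma volume_gNorm_lt_lt_top (r : ℝ) : volume {z : GPt n | gNorm z < r} < ⊤ := by
  refine lt_of_le_of_lt (measure_mono (t := Metric.closedBall 0 (max r (r ^ 2))) ?_)
    measure_closedBall_lt_top
  intro z hz
  have hz' : gNorm z ≤ r := le_of_lt hz
  have h1 := norm_fst_le_gNorm z
  have h2 := two_mul_abs_snd_le_gNorm_sq z
  have h3 : gNorm z ^ 2 ≤ r ^ 2 := pow_le_pow_left₀ (gNorm_nonneg z) hz' 2
  rw [mem_closedBall_zero_iff, Prod.norm_def]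
  refine max_le ((h1.trans hz').trans (le_max_left _ _)) (le_trans ?_ (le_max_right _ _))
  rw [Real.norm_eq_abs]
  linarith [abs_nonneg z.2]

lemma lintegral_comp_dil {s : ℝ} (hs : 0 < s) {f : GPt n → ENNReal} (hf : Measurable f) :
    ∫⁻ z, f (dil s z) = ENNReal.ofReal ((s ^ (n + 2))⁻¹) * ∫⁻ z, f z := by
  have hmap : Measure.map (dil s) (volume : Measure (GPt n)) =
      ENNReal.ofReal ((s ^ (n + 2))⁻¹) • (volume : Measure (GPt n)) := by
    have h1 : (dil s : GPt n → GPt n) =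
        Prod.map (fun x : EuclideanSpace ℝ (Fin n) => s • x) (fun t : ℝ => s ^ 2 • t) := by
      ext z <;> simp [dil]
    rw [h1, Measure.volume_eq_prod, ← Measure.map_prod_map _ _ (by fun_prop) (by fun_prop),
      Measure.map_addHaar_smul _ hs.ne', Measure.map_addHaar_smul _ (pow_pos hs 2).ne',
      Measure.prod_smul_left, Measure.prod_smul_right, smul_smul,
      ← ENNReal.ofReal_mul (abs_nonneg _)]
    congr 2
    rw [abs_of_pos (by positivity), abs_of_pos (by positivity)]
    simp only [finrank_euclideanSpace, Fintype.card_fin, Module.finrank_self, pow_one]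
    rw [pow_add, mul_inv]
  have hmeas : Measurable (dil s : GPt n → GPt n) :=
    (continuous_dil.comp (continuous_const.prodMk continuous_id)).measurable
  rw [← lintegral_map hf hmeas, hmap, lintegral_smul_measure, smul_eq_mul]

lemma lintegral_indicator_gShell_dil {z : GPt n} (hz : z ≠ 0) :
    ∫⁻ τ : ℝ, (gShell n).indicator (1 : GPt n → ENNReal) (dil (Real.exp τ) z) = 1 := by
  have hg := gNorm_pos hz
  have h : ∀ τ : ℝ, (gShell n).indicator (1 : GPt n → ENNReal) (dil (Real.exp τ) z) =
      (Set.Ico (-Real.log (gNorm z)) (1 - Real.log (gNorm z))).indicator 1 τ := by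
    intro τ
    have : dil (Real.exp τ) z ∈ gShell n ↔
        τ ∈ Set.Ico (-Real.log (gNorm z)) (1 - Real.log (gNorm z)) := by
      simp only [gShell, Set.mem_ofPred_eq, Set.mem_Ico, gNorm_dil (Real.exp_pos τ).le]
      have e : Real.exp τ * gNorm z = Real.exp (τ + Real.log (gNorm z)) := by
        rw [Real.exp_add, Real.exp_log hg]
      rw [e, Real.exp_lt_exp, Real.one_le_exp_iff]
      constructor <;> rintro ⟨h1, h2⟩ <;> constructor <;> linarith
    by_cases hτ : dil (Real.exp τ) z ∈ gShell n
    · rw [Set.indicator_of_mem hτ, Set.indicator_of_mem (this.1 hτ)]; rfl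
    · rw [Set.indicator_of_notMem hτ, Set.indicator_of_notMem fun h => hτ (this.2 h)]
  simp_rw [h]
  rw [lintegral_indicator_one measurableSet_Ico, Real.volume_Ico]
  simp

lemma measurable_weight (a : ℝ) : Measurable fun z : GPt n => ENNReal.ofReal (gNorm z ^ a) :=
  (continuous_gNorm.measurable.pow_const a).ennreal_ofReal

/-- Integration in anisotropic polar coordinates, with the unit sphere replaced by a shell. -/
lemma lintegral_polar {Φ : GPt n → ENNReal} (hΦ : Measurable Φ) :
    ∫⁻ z : GPt n, ENNReal.ofReal (gNorm z ^ (-((n : ℝ) + 2))) * Φ z =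
      ∫⁻ z in gShell n, ENNReal.ofReal (gNorm z ^ (-((n : ℝ) + 2))) *
        ∫⁻ τ : ℝ, Φ (dil (Real.exp τ) z) := by
  set w : GPt n → ENNReal := fun z => ENNReal.ofReal (gNorm z ^ (-((n : ℝ) + 2))) with hw
  set χ : GPt n → ENNReal := (gShell n).indicator 1 with hχ
  have hwm : Measurable w := measurable_weight _
  have hχm : Measurable χ := measurable_one.indicator measurableSet_gShell
  have hd : ∀ τ : ℝ, Measurable (dil (Real.exp τ) : GPt n → GPt n) := fun τ =>
    measurable_dil_exp.comp (measurable_const.prodMk measurable_id)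
  have hd' : ∀ z : GPt n, Measurable fun τ : ℝ => dil (Real.exp τ) z := fun z =>
    measurable_dil_exp.comp (measurable_id.prodMk measurable_const)
  have h1 : ∫⁻ z, w z * Φ z = ∫⁻ z, ∫⁻ τ : ℝ, w z * Φ z * χ (dil (Real.exp τ) z) := by
    refine lintegral_congr_ae ?_
    have hne : ∀ᵐ z : GPt n, z ≠ 0 := by
      have h0 : (volume : Measure (GPt n)) {0} = 0 := by
        rw [Measure.volume_eq_prod]
        exact measure_singleton _
      simpa [ae_iff] using h0
    filter_upwards [hne] with z hz
    have hm : Measurable fun τ : ℝ => χ (dil (Real.exp τ) z) := hχm.comp (hd' z)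
    rw [lintegral_const_mul _ hm, lintegral_indicator_gShell_dil hz, mul_one]
  have h2 : ∀ τ : ℝ, ∫⁻ z, w z * Φ z * χ (dil (Real.exp τ) z) =
      ∫⁻ z, w z * Φ (dil (Real.exp (-τ)) z) * χ z := by
    intro τ
    have hinv : ∀ z : GPt n, dil (Real.exp (-τ)) (dil (Real.exp τ) z) = z := fun z => by
      rw [dil_dil, ← Real.exp_add, neg_add_cancel, Real.exp_zero, dil_one]
    have hm : Measurable fun z => w (dil (Real.exp (-τ)) z) * Φ (dil (Real.exp (-τ)) z) * χ z :=
      ((hwm.comp (hd _)).mul (hΦ.comp (hd _))).mul hχm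
    have h3 := lintegral_comp_dil (Real.exp_pos τ) hm
    simp only [hinv] at h3
    rw [h3, ← lintegral_const_mul _ hm]
    refine lintegral_congr fun z => ?_
    have hwz : w (dil (Real.exp (-τ)) z) = ENNReal.ofReal (Real.exp τ ^ (n + 2)) * w z := by
      simp only [hw]
      rw [gNorm_dil (Real.exp_pos _).le, Real.mul_rpow (Real.exp_pos _).le (gNorm_nonneg z),
        ENNReal.ofReal_mul (by positivity)]
      congr 2
      rw [← Real.exp_mul, ← Real.exp_nat_mul]
      push_cast
      ring_nf
    rw [hwz]
    simp only [← mul_assoc]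
    rw [← ENNReal.ofReal_mul (by positivity), inv_mul_cancel₀ (by positivity)]
    simp
  rw [h1, lintegral_lintegral_swap, lintegral_congr h2, ← lintegral_neg_eq_self]
  · simp only [neg_neg]
    rw [lintegral_lintegral_swap, ← lintegral_indicator measurableSet_gShell]
    · refine lintegral_congr fun z => ?_
      by_cases hz : z ∈ gShell n
      · have hm : Measurable fun τ : ℝ => Φ (dil (Real.exp τ) z) := hΦ.comp (hd' z)
        rw [Set.indicator_of_mem hz, ← lintegral_const_mul _ hm]
        simp only [hχ, hw, Set.indicator_of_mem hz, Pi.one_apply, mul_one]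
      · simp [hχ, hz]
    · exact (((hwm.comp measurable_snd).mul (hΦ.comp measurable_dil_exp)).mul
        (hχm.comp measurable_snd)).aemeasurable
  · exact (((hwm.comp measurable_fst).mul (hΦ.comp measurable_fst)).mul
      (hχm.comp (measurable_dil_exp.comp measurable_swap))).aemeasurable

/-- The angular factor in the polar form of the two sides of the Rellich inequality. -/
def angWeight (p : ℝ) {n : ℕ} (z : GPt n) : ENNReal :=
  ENNReal.ofReal (gNorm z ^ (-((n : ℝ) + 2)) * gPsi z ^ (p / 2))

lemma measurable_angWeight (p : ℝ) : Measurable (angWeight p : GPt n → ENNReal) :=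
  ((continuous_gNorm.measurable.pow_const _).mul (measurable_gPsi.pow_const _)).ennreal_ofReal

lemma lintegral_ball_polar (p : ℝ) {R : ℝ} (hR : 0 < R) {g : GPt n → ℝ} (hg : Measurable g) :
    ∫⁻ z in {z : GPt n | gNorm z < R},
        ENNReal.ofReal (gNorm z ^ (-((n : ℝ) + 2)) * gPsi z ^ (p / 2) * g z) =
      ∫⁻ z in gShell n, angWeight p z *
        ∫⁻ τ in Set.Ioi (0 : ℝ),
          ENNReal.ofReal (g (dil (Real.exp (-τ)) (dil (R / gNorm z) z))) := by
  set B : Set (GPt n) := {z : GPt n | gNorm z < R} with hB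
  have hBm : MeasurableSet B := measurableSet_lt continuous_gNorm.measurable measurable_const
  set Φ : GPt n → ENNReal :=
    B.indicator fun z => ENNReal.ofReal (gPsi z ^ (p / 2)) * ENNReal.ofReal (g z) with hΦdef
  have hΦ : Measurable Φ :=
    ((measurable_gPsi.pow_const _).ennreal_ofReal.mul hg.ennreal_ofReal).indicator hBm
  have h1 := lintegral_polar hΦ
  have h2 : ∫⁻ z in B, ENNReal.ofReal (gNorm z ^ (-((n : ℝ) + 2)) * gPsi z ^ (p / 2) * g z) =
      ∫⁻ z : GPt n, ENNReal.ofReal (gNorm z ^ (-((n : ℝ) + 2))) * Φ z := by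
    rw [← lintegral_indicator hBm]
    refine lintegral_congr fun z => ?_
    by_cases hz : z ∈ B
    · simp only [hΦdef, Set.indicator_of_mem hz]
      have := Real.rpow_nonneg (gNorm_nonneg z) (-((n : ℝ) + 2))
      have := Real.rpow_nonneg (gPsi_nonneg z) (p / 2)
      rw [ENNReal.ofReal_mul (by positivity), ENNReal.ofReal_mul (by positivity), mul_assoc]
    · simp only [hΦdef, Set.indicator_of_notMem hz, mul_zero]
  rw [h2, h1]
  refine setLIntegral_congr_fun measurableSet_gShell fun z hz => ?_
  have hgz := gNorm_pos (ne_zero_of_mem_gShell hz)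
  have hrR : 0 < R / gNorm z := div_pos hR hgz
  have key : ∀ τ : ℝ, Φ (dil (Real.exp (Real.log (R / gNorm z) - τ)) z) =
      ENNReal.ofReal (gPsi z ^ (p / 2)) * (Set.Ioi (0 : ℝ)).indicator (fun τ =>
        ENNReal.ofReal (g (dil (Real.exp (-τ)) (dil (R / gNorm z) z)))) τ := by
    intro τ
    have hd : dil (Real.exp (Real.log (R / gNorm z) - τ)) z =
        dil (Real.exp (-τ)) (dil (R / gNorm z) z) := by
      rw [dil_dil, sub_eq_add_neg, Real.exp_add, Real.exp_log hrR, mul_comm]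
    rw [hd]
    have hψ : gPsi (dil (Real.exp (-τ)) (dil (R / gNorm z) z)) = gPsi z := by
      rw [gPsi_dil (Real.exp_pos _), gPsi_dil hrR]
    have hmem : dil (Real.exp (-τ)) (dil (R / gNorm z) z) ∈ B ↔ τ ∈ Set.Ioi (0 : ℝ) := by
      simp only [hB, Set.mem_ofPred_eq, gNorm_dil (Real.exp_pos _).le, gNorm_dil hrR.le, Set.mem_Ioi]
      rw [div_mul_cancel₀ _ hgz.ne', mul_lt_iff_lt_one_left hR, Real.exp_lt_one_iff,
        neg_lt_zero]
    by_cases hτ : τ ∈ Set.Ioi (0 : ℝ)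
    · rw [Set.indicator_of_mem hτ]
      simp only [hΦdef, Set.indicator_of_mem (hmem.2 hτ), hψ]
    · rw [Set.indicator_of_notMem hτ]
      simp only [hΦdef, Set.indicator_of_notMem fun h => hτ (hmem.1 h), mul_zero]
  have hm : Measurable fun τ : ℝ =>
      ENNReal.ofReal (g (dil (Real.exp (-τ)) (dil (R / gNorm z) z))) := by
    refine Measurable.ennreal_ofReal (hg.comp ?_)
    exact (continuous_dil.comp (by fun_prop :
      Continuous fun τ : ℝ => (Real.exp (-τ), dil (R / gNorm z) z))).measurable
  rw [← lintegral_sub_left_eq_self _ (Real.log (R / gNorm z)), lintegral_congr key,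
    lintegral_const_mul _ (hm.indicator measurableSet_Ioi),
    lintegral_indicator measurableSet_Ioi, angWeight,
    ENNReal.ofReal_mul (Real.rpow_nonneg hgz.le _), mul_assoc]

lemma lintegral_angWeight_lt_top {p : ℝ} (hp : 0 ≤ p) :
    ∫⁻ z in gShell n, angWeight p z < ⊤ := by
  have hle : ∀ z ∈ gShell n, angWeight p z ≤ 1 := by
    intro z hz
    rw [angWeight, ENNReal.ofReal_le_one]
    have h1 : gNorm z ^ (-((n : ℝ) + 2)) ≤ 1 :=
      Real.rpow_le_one_of_one_le_of_nonpos hz.1 (by linarith [(Nat.cast_nonneg n : (0 : ℝ) ≤ n)])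
    have h2 : gPsi z ^ (p / 2) ≤ 1 :=
      Real.rpow_le_one (gPsi_nonneg z) (gPsi_le_one z) (by positivity)
    exact mul_le_one₀ h1 (Real.rpow_nonneg (gPsi_nonneg z) _) h2
  refine lt_of_le_of_lt (setLIntegral_mono' measurableSet_gShell hle) ?_
  rw [setLIntegral_one]
  exact lt_of_le_of_lt (measure_mono fun z hz => hz.2) (volume_gNorm_lt_lt_top (Real.exp 1))

lemma lintegral_angWeight_pos (hn : 0 < n) (p : ℝ) :
    0 < ∫⁻ z in gShell n, angWeight p z := by
  rw [setLIntegral_pos_iff (measurable_angWeight p)]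
  set U : Set (GPt n) := {z | 1 < gNorm z ∧ gNorm z < Real.exp 1 ∧ 0 < ‖z.1‖}
  have hU : IsOpen U :=
    (isOpen_lt continuous_const continuous_gNorm).inter
      ((isOpen_lt continuous_gNorm continuous_const).inter
        (isOpen_lt continuous_const continuous_fst.norm))
  have hne : U.Nonempty := by
    set x : EuclideanSpace ℝ (Fin n) := EuclideanSpace.single ⟨0, hn⟩ (2 : ℝ)
    have hx : ‖x‖ = 2 := by simp [x]
    have hz : gNorm ((x, 0) : GPt n) = 2 := by
      refine (pow_left_inj₀ (gNorm_nonneg _) (by norm_num) (n := 4) (by norm_num)).1 ?_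
      rw [gNorm_pow_four]
      simp [hx]
    refine ⟨(x, 0), ?_, ?_, ?_⟩
    · rw [hz]; norm_num
    · rw [hz]; exact lt_trans (by norm_num) Real.exp_one_gt_d9
    · simp [hx]
  refine lt_of_lt_of_le (hU.measure_pos volume hne) (measure_mono ?_)
  rintro z ⟨h1, h2, h3⟩
  refine ⟨?_, h1.le, h2⟩
  have hg : 0 < gNorm z := by linarith
  rw [Function.mem_support, angWeight, Ne, ENNReal.ofReal_eq_zero, not_le]
  have hψ : 0 < gPsi z := by unfold gPsi; positivity
  positivity

end Polar

section OneDimensional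

open Filter Topology

lemma abs_rpow_tangent {p : ℝ} (hp : 1 < p) (A B : ℝ) :
    |B| ^ p + p * |B| ^ (p - 2) * B * (A - B) ≤ |A| ^ p := by
  rcases eq_or_ne B 0 with rfl | hB
  · simp only [abs_zero, Real.zero_rpow (by linarith : p ≠ 0), mul_zero, zero_mul, add_zero]
    positivity
  have hB' : 0 < |B| := abs_pos.2 hB
  have e1 : |B| ^ p = |B| ^ (p - 2) * B ^ 2 := by
    rw [← sq_abs B, ← Real.rpow_natCast, ← Real.rpow_add hB']
    norm_num
  have h1 := one_add_mul_self_le_rpow_one_add (s := |A| / |B| - 1)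
    (by linarith [div_nonneg (abs_nonneg A) hB'.le]) hp.le
  rw [add_sub_cancel, Real.div_rpow (abs_nonneg A) hB'.le,
    le_div_iff₀ (Real.rpow_pos_of_pos hB' p)] at h1
  refine le_trans ?_ h1
  have e2 : |A| / |B| * B ^ 2 = |A| * |B| := by
    rw [← sq_abs B]; field_simp
  have h3 : B * A ≤ |A| * |B| := by
    rw [mul_comm, ← abs_mul]; exact le_abs_self _
  have h4 : 0 ≤ p * |B| ^ (p - 2) := by positivity
  rw [e1]
  nlinarith [mul_le_mul_of_nonneg_left h3 h4, e2]

/-- Pointwise form of the one-dimensional inequality: the difference of the two integrands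
dominates an exact derivative. -/
lemma critical_pointwise {p a : ℝ} (hp : 1 < p) (ha : 0 < a) {τ : ℝ} (hτ : 0 < τ)
    (f f1 f2 : ℝ) :
    (a * ((p - 1) / p)) ^ p * (|f| ^ p / τ ^ p) +
      (a ^ p * ((p - 1) / p) ^ (p - 1) *
          (p * |f| ^ (p - 2) * f * f1 * τ ^ (1 - p) + |f| ^ p * ((1 - p) * τ ^ (1 - p - 1))) -
        a ^ (p - 1) * (p * |f1| ^ (p - 2) * f1 * f2)) ≤ |f2 - a * f1| ^ p := by
  set c := (p - 1) / p with hc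
  have hc0 : 0 < c := div_pos (by linarith) (by linarith)
  have hpc : p * c = p - 1 := by rw [hc]; field_simp
  clear_value c
  have h1 := abs_rpow_tangent hp (f2 - a * f1) (-(a * f1))
  have h2 := abs_rpow_tangent hp f1 (c * f / τ)
  have sq : ∀ x : ℝ, |x| ^ p = |x| ^ (p - 2) * x ^ 2 := by
    intro x
    rcases eq_or_ne x 0 with rfl | hx
    · simp [Real.zero_rpow (by linarith : p ≠ 0)]
    · rw [← sq_abs x, ← Real.rpow_natCast, ← Real.rpow_add (abs_pos.2 hx)]
      norm_num
  have spl : ∀ x : ℝ, 0 < x → x ^ p = x ^ (p - 2) * x ^ 2 ∧ x ^ (p - 1) = x ^ (p - 2) * x := by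
    intro x hx
    constructor
    · rw [← Real.rpow_natCast, ← Real.rpow_add hx]; norm_num
    · nth_rewrite 3 [← Real.rpow_one x]
      rw [← Real.rpow_add hx]; ring_nf
  have hτ1 : τ ^ (1 - p) = (τ ^ (p - 2))⁻¹ * τ⁻¹ := by
    rw [← mul_inv, ← (spl τ hτ).2, ← Real.rpow_neg hτ.le]; ring_nf
  have hτ2 : τ ^ (1 - p - 1) = (τ ^ (p - 2))⁻¹ * (τ ^ 2)⁻¹ := by
    rw [← mul_inv, ← (spl τ hτ).1, ← Real.rpow_neg hτ.le]; ring_nf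
  rw [abs_neg, abs_mul, abs_of_pos ha, Real.mul_rpow ha.le (abs_nonneg _),
    Real.mul_rpow ha.le (abs_nonneg _)] at h1
  rw [abs_div, abs_mul, abs_of_pos hc0, abs_of_pos hτ, Real.div_rpow (by positivity) hτ.le,
    Real.div_rpow (by positivity) hτ.le, Real.mul_rpow hc0.le (abs_nonneg _),
    Real.mul_rpow hc0.le (abs_nonneg _)] at h2
  have h3 := mul_le_mul_of_nonneg_left h2 (Real.rpow_pos_of_pos ha p).le
  refine le_trans (le_of_eq ?_) (le_trans (add_le_add_left h3
    (-(a ^ (p - 1) * (p * |f1| ^ (p - 2) * f1 * f2)))) (le_trans (le_of_eq ?_) h1))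
  · rw [Real.mul_rpow ha.le hc0.le, hτ1, hτ2, (spl c hc0).1, (spl c hc0).2, (spl τ hτ).1, sq f]
    have : τ ^ (p - 2) ≠ 0 := (Real.rpow_pos_of_pos hτ _).ne'
    field_simp
    linear_combination (a ^ p * c ^ (p - 2) * c * |f| ^ (p - 2) * f ^ 2) * hpc
  · rw [(spl a ha).1, (spl a ha).2, sq f1]
    ring

/-- The one-dimensional critical Rellich inequality, in logarithmic coordinates. -/
lemma lintegral_critical {p a : ℝ} (hp : 1 < p) (ha : 0 < a) {f f1 f2 : ℝ → ℝ}
    (hf : ∀ τ, HasDerivAt f (f1 τ) τ) (hf1 : ∀ τ, HasDerivAt f1 (f2 τ) τ) (hf2 : Continuous f2)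
    {τ₀ : ℝ} (hτ₀ : 0 < τ₀) (h0 : ∀ τ ≤ τ₀, f τ = 0) (h10 : f1 τ₀ = 0)
    (hlim : Tendsto f1 atTop (𝓝 0)) :
    ENNReal.ofReal ((a * ((p - 1) / p)) ^ p) *
        ∫⁻ τ in Set.Ioi (0 : ℝ), ENNReal.ofReal (|f τ| ^ p / τ ^ p) ≤
      ∫⁻ τ in Set.Ioi (0 : ℝ), ENNReal.ofReal (|f2 τ - a * f1 τ| ^ p) := by
  set c := (p - 1) / p with hc
  have hc0 : 0 < c := div_pos (by linarith) (by linarith)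
  have hp0 : 0 ≤ p := by linarith
  have hfc : Continuous f := continuous_iff_continuousAt.2 fun τ => (hf τ).continuousAt
  have hf1c : Continuous f1 := continuous_iff_continuousAt.2 fun τ => (hf1 τ).continuousAt
  have hnum : Continuous fun τ => |f τ| ^ p := hfc.abs.rpow_const fun _ => Or.inr hp0
  have hL : Continuous fun τ => |f2 τ - a * f1 τ| ^ p :=
    (hf2.sub (continuous_const.mul hf1c)).abs.rpow_const fun _ => Or.inr hp0
  have hR : ContinuousOn (fun τ => (a * c) ^ p * (|f τ| ^ p / τ ^ p)) (Set.Ioi 0) := by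
    refine continuousOn_const.mul (hnum.continuousOn.div ?_ fun τ hτ =>
      (Real.rpow_pos_of_pos hτ p).ne')
    exact continuousOn_id.rpow_const fun τ _ => Or.inr hp0
  set h : ℝ → ℝ := fun τ =>
    a ^ p * c ^ (p - 1) * (|f τ| ^ p * τ ^ (1 - p)) - a ^ (p - 1) * |f1 τ| ^ p with hh
  have hder : ∀ τ : ℝ, 0 < τ → HasDerivAt h
      (a ^ p * c ^ (p - 1) *
          (p * |f τ| ^ (p - 2) * f τ * f1 τ * τ ^ (1 - p) +
            |f τ| ^ p * ((1 - p) * τ ^ (1 - p - 1))) -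
        a ^ (p - 1) * (p * |f1 τ| ^ (p - 2) * f1 τ * f2 τ)) τ := by
    intro τ hτ
    have d1 := (hasDerivAt_abs_rpow (f τ) hp).comp τ (hf τ)
    have d2 := (hasDerivAt_abs_rpow (f1 τ) hp).comp τ (hf1 τ)
    have d3 := Real.hasDerivAt_rpow_const (x := τ) (p := 1 - p) (Or.inl hτ.ne')
    exact ((d1.mul d3).const_mul _).sub (d2.const_mul _)
  have hfin : ∀ T : ℝ, τ₀ ≤ T →
      ∫⁻ τ in Set.Ioc τ₀ T, ENNReal.ofReal ((a * c) ^ p * (|f τ| ^ p / τ ^ p)) ≤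
        (∫⁻ τ in Set.Ioi (0 : ℝ), ENNReal.ofReal (|f2 τ - a * f1 τ| ^ p)) +
          ENNReal.ofReal (a ^ (p - 1) * |f1 T| ^ p) := by
    intro T hT
    have hsub : Set.Icc τ₀ T ⊆ Set.Ioi 0 := fun x hx => hτ₀.trans_le hx.1
    have hRi : IntegrableOn (fun τ => (a * c) ^ p * (|f τ| ^ p / τ ^ p)) (Set.Icc τ₀ T) :=
      (hR.mono hsub).integrableOn_Icc
    have hLi : IntegrableOn (fun τ => |f2 τ - a * f1 τ| ^ p) (Set.Icc τ₀ T) :=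
      hL.continuousOn.integrableOn_Icc
    have hRi' := hRi.mono_set Set.Ioc_subset_Icc_self
    have hLi' := hLi.mono_set Set.Ioc_subset_Icc_self
    have key := intervalIntegral.sub_le_integral_of_hasDeriv_right_of_le (g := h)
      (φ := fun τ => |f2 τ - a * f1 τ| ^ p - (a * c) ^ p * (|f τ| ^ p / τ ^ p)) hT
      (fun τ hτ => (hder τ (hsub hτ)).continuousAt.continuousWithinAt)
      (fun τ hτ => (hder τ (hsub (Set.Ioo_subset_Icc_self hτ))).hasDerivWithinAt)
      (hLi.sub hRi)
      (fun τ hτ => by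
        have := critical_pointwise hp ha (hsub (Set.Ioo_subset_Icc_self hτ)) (f τ) (f1 τ) (f2 τ)
        linarith)
    rw [intervalIntegral.integral_of_le hT, integral_sub hLi' hRi'] at key
    have hz : h τ₀ = 0 := by
      simp [hh, h0 τ₀ le_rfl, h10, Real.zero_rpow (by linarith : p ≠ 0)]
    have hT' : -h T ≤ a ^ (p - 1) * |f1 T| ^ p := by
      have : 0 < T := hτ₀.trans_le hT
      have : 0 ≤ a ^ p * c ^ (p - 1) * (|f T| ^ p * T ^ (1 - p)) := by positivity
      simp only [hh]
      linarith
    rw [← ofReal_integral_eq_lintegral_ofReal hRi']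
    · have hle : ∫ τ in Set.Ioc τ₀ T, (a * c) ^ p * (|f τ| ^ p / τ ^ p) ≤
          (∫ τ in Set.Ioc τ₀ T, |f2 τ - a * f1 τ| ^ p) + a ^ (p - 1) * |f1 T| ^ p := by
        linarith
      refine (ENNReal.ofReal_le_ofReal hle).trans (ENNReal.ofReal_add_le.trans ?_)
      gcongr
      rw [ofReal_integral_eq_lintegral_ofReal hLi' (ae_of_all _ fun τ => by positivity)]
      exact lintegral_mono_set fun τ hτ => hτ₀.trans hτ.1
    · refine (ae_restrict_iff' measurableSet_Ioc).2 (ae_of_all _ fun τ hτ => ?_)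
      have : 0 < τ := hτ₀.trans hτ.1
      simp only [Pi.zero_apply]
      positivity
  have hRm : Measurable fun τ : ℝ => ENNReal.ofReal (|f τ| ^ p / τ ^ p) :=
    (hnum.measurable.div (measurable_id.pow_const p)).ennreal_ofReal
  have hRm' : Measurable fun τ : ℝ => ENNReal.ofReal ((a * c) ^ p * (|f τ| ^ p / τ ^ p)) :=
    ((hnum.measurable.div (measurable_id.pow_const p)).const_mul _).ennreal_ofReal
  have hsplit : ENNReal.ofReal ((a * c) ^ p) *
        ∫⁻ τ in Set.Ioi (0 : ℝ), ENNReal.ofReal (|f τ| ^ p / τ ^ p) =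
      ∫⁻ τ in Set.Ioi τ₀, ENNReal.ofReal ((a * c) ^ p * (|f τ| ^ p / τ ^ p)) := by
    rw [← lintegral_const_mul _ hRm, ← lintegral_indicator measurableSet_Ioi,
      ← lintegral_indicator measurableSet_Ioi]
    refine lintegral_congr fun τ => ?_
    rcases le_or_gt τ τ₀ with hτ | hτ
    · rw [Set.indicator_of_notMem (s := Set.Ioi τ₀) (by simpa using hτ)]
      refine Set.indicator_apply_eq_zero.2 fun _ => ?_
      simp [h0 τ hτ, Real.zero_rpow (by linarith : p ≠ 0)]
    · rw [Set.indicator_of_mem (Set.mem_Ioi.2 (hτ₀.trans hτ)),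
        Set.indicator_of_mem (Set.mem_Ioi.2 hτ), ENNReal.ofReal_mul (by positivity)]
  rw [hsplit]
  have hcov := (aecover_Iic (μ := volume.restrict (Set.Ioi τ₀))
    (tendsto_id : Tendsto id atTop atTop)).lintegral_tendsto_of_countably_generated
      hRm'.aemeasurable
  have hbd : Tendsto (fun T => (∫⁻ τ in Set.Ioi (0 : ℝ), ENNReal.ofReal (|f2 τ - a * f1 τ| ^ p)) +
      ENNReal.ofReal (a ^ (p - 1) * |f1 T| ^ p)) atTop
      (𝓝 ((∫⁻ τ in Set.Ioi (0 : ℝ), ENNReal.ofReal (|f2 τ - a * f1 τ| ^ p)) + 0)) := by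
    refine tendsto_const_nhds.add ?_
    have : Tendsto (fun T => a ^ (p - 1) * |f1 T| ^ p) atTop (𝓝 0) := by
      have := ((hlim.abs.rpow_const (p := p) (Or.inr hp0))).const_mul (a ^ (p - 1))
      simpa [Real.zero_rpow (by linarith : p ≠ 0)] using this
    simpa using ENNReal.tendsto_ofReal this
  rw [add_zero] at hbd
  refine le_of_tendsto_of_tendsto hcov hbd ?_
  filter_upwards [eventually_ge_atTop τ₀] with T hT
  rw [Measure.restrict_restrict measurableSet_Iic, Set.inter_comm, id, Set.Ioi_inter_Iic]
  exact hfin T hT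

end OneDimensional

section Inequality

open Filter Topology

variable {n : ℕ}

/-- The numerator of the Rellich integrand along dilation orbits. -/
def lapEul (Q : ℝ) (u : GPt n → ℝ) (z : GPt n) : ℝ := eul (eul u) z + (Q - 2) * eul u z

lemma contDiff_lapEul (Q : ℝ) {u : GPt n → ℝ} (hu : ContDiff ℝ (⊤ : ℕ∞) u) :
    ContDiff ℝ (⊤ : ℕ∞) (lapEul Q u) :=
  (contDiff_eul (contDiff_eul hu)).add (contDiff_const.mul (contDiff_eul hu))

lemma exists_eul_bound {s : Set (GPt n)} {u : GPt n → ℝ} (hu : IsTest s u) :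
    ∃ C, 0 ≤ C ∧ ∀ z, |eul u z| ≤ C * (gNorm z + gNorm z ^ 2) := by
  obtain ⟨C, hC⟩ := (hu.2.1.fderiv (𝕜 := ℝ)).exists_bound_of_continuous
    (hu.1.continuous_fderiv (by simp))
  have hC0 : 0 ≤ C := (norm_nonneg _).trans (hC 0)
  refine ⟨C, hC0, fun z => ?_⟩
  have h1 := norm_fst_le_gNorm z
  have h2 := two_mul_abs_snd_le_gNorm_sq z
  have h3 : ‖((z.1, 2 * z.2) : GPt n)‖ ≤ gNorm z + gNorm z ^ 2 := by
    rw [Prod.norm_def]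
    refine max_le ?_ ?_
    · simpa using h1.trans (le_add_of_nonneg_right (sq_nonneg _))
    · simpa [abs_mul] using h2.trans (le_add_of_nonneg_left (gNorm_nonneg z))
  rw [← Real.norm_eq_abs]
  exact ((fderiv ℝ u z).le_opNorm _).trans (mul_le_mul (hC z) h3 (norm_nonneg _) hC0)

lemma exists_lapEul_bound (Q R : ℝ) {s : Set (GPt n)} {u : GPt n → ℝ} (hu : IsTest s u) :
    ∃ C, 0 ≤ C ∧ ∀ z, gNorm z ≤ R → |lapEul Q u z| ≤ C * gNorm z := by
  obtain ⟨C₁, h₁, hC₁⟩ := exists_eul_bound hu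
  obtain ⟨C₂, h₂, hC₂⟩ := exists_eul_bound (isTest_eul hu)
  have key : 0 ≤ (C₂ + |Q - 2| * C₁) * (1 + |R|) := by positivity
  refine ⟨(C₂ + |Q - 2| * C₁) * (1 + |R|), key, fun z hz => ?_⟩
  have hg := gNorm_nonneg z
  have h3 : gNorm z + gNorm z ^ 2 ≤ (1 + |R|) * gNorm z := by
    nlinarith [le_abs_self R]
  calc |lapEul Q u z| ≤ |eul (eul u) z| + |Q - 2| * |eul u z| := by
        rw [← abs_mul]; exact abs_add_le _ _
    _ ≤ C₂ * (gNorm z + gNorm z ^ 2) + |Q - 2| * (C₁ * (gNorm z + gNorm z ^ 2)) := by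
        gcongr
        · exact hC₂ z
        · exact hC₁ z
    _ = (C₂ + |Q - 2| * C₁) * (gNorm z + gNorm z ^ 2) := by ring
    _ ≤ (C₂ + |Q - 2| * C₁) * ((1 + |R|) * gNorm z) := by gcongr
    _ = _ := by ring

lemma exists_radius {R : ℝ} (hR : 0 < R) {u : GPt n → ℝ}
    (hu : IsTest {z : GPt n | gNorm z < R} u) :
    ∃ r, 0 < r ∧ r < R ∧ ∀ z, r ≤ gNorm z → z ∉ tsupport u := by
  rcases (tsupport u).eq_empty_or_nonempty with h | h
  · exact ⟨R / 2, by linarith, by linarith, fun z _ => by simp [h]⟩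
  · obtain ⟨z₀, hz₀, hmax⟩ := hu.2.1.isCompact.exists_isMaxOn h continuous_gNorm.continuousOn
    have h1 : gNorm z₀ < R := hu.2.2 hz₀
    have h2 := gNorm_nonneg z₀
    refine ⟨(gNorm z₀ + R) / 2, by linarith, by linarith, fun z hz hzs => ?_⟩
    have h3 : gNorm z ≤ gNorm z₀ := hmax hzs
    linarith

lemma tendsto_dil_exp_neg (z : GPt n) :
    Tendsto (fun τ : ℝ => dil (Real.exp (-τ)) z) atTop (𝓝 0) := by
  have h1 : Tendsto (fun τ : ℝ => Real.exp (-τ)) atTop (𝓝 0) :=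
    Real.tendsto_exp_neg_atTop_nhds_zero
  have h2 := (continuous_dil (n := n)).tendsto ((0 : ℝ), z)
  simp only [dil_zero_left] at h2
  exact h2.comp (h1.prodMk_nhds tendsto_const_nhds)

lemma continuous_dil_exp_neg (z : GPt n) : Continuous fun τ : ℝ => dil (Real.exp (-τ)) z :=
  continuous_dil.comp (by fun_prop : Continuous fun τ : ℝ => (Real.exp (-τ), z))

/-- The critical Rellich inequality along a single dilation orbit. -/
lemma lintegral_orbit_critical {Q p R : ℝ} (hQ : 2 < Q) (hp : 1 < p) (hR : 0 < R)
    {u : GPt n → ℝ} (hu : IsTest {z : GPt n | gNorm z < R} u) {z : GPt n} (hz : gNorm z = R) :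
    ENNReal.ofReal (((Q - 2) * (p - 1) / p) ^ p) *
        ∫⁻ τ in Set.Ioi (0 : ℝ), ENNReal.ofReal (|u (dil (Real.exp (-τ)) z)| ^ p /
          Real.log (R / gNorm (dil (Real.exp (-τ)) z)) ^ p) ≤
      ∫⁻ τ in Set.Ioi (0 : ℝ), ENNReal.ofReal (|lapEul Q u (dil (Real.exp (-τ)) z)| ^ p) := by
  obtain ⟨r, hr0, hrR, hr⟩ := exists_radius hR hu
  have hu1 := contDiff_eul hu.1
  have hu2 := contDiff_eul hu1
  set τ₀ := Real.log (R / r) with hτ₀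
  have hτ₀pos : 0 < τ₀ := Real.log_pos ((one_lt_div hr0).2 hrR)
  have hfar : ∀ τ ≤ τ₀, dil (Real.exp (-τ)) z ∉ tsupport u := by
    intro τ hτ
    refine hr _ ?_
    rw [gNorm_dil (Real.exp_pos _).le, hz]
    have : Real.exp (-τ₀) * R = r := by
      rw [Real.exp_neg, hτ₀, Real.exp_log (by positivity)]
      field_simp
    rw [← this]
    gcongr
  have hlim : Tendsto (fun τ => -eul u (dil (Real.exp (-τ)) z)) atTop (𝓝 0) := by
    have := (hu1.continuous.tendsto 0).comp (tendsto_dil_exp_neg z)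
    rw [eul_zero] at this
    simpa using this.neg
  have key := lintegral_critical hp (sub_pos.2 hQ)
    (f := fun τ => u (dil (Real.exp (-τ)) z))
    (f1 := fun τ => -eul u (dil (Real.exp (-τ)) z))
    (f2 := fun τ => eul (eul u) (dil (Real.exp (-τ)) z))
    (fun τ => hasDerivAt_comp_dil_exp_neg (hu.1.differentiable (by simp)) z τ)
    (fun τ => (hasDerivAt_comp_dil_exp_neg (hu1.differentiable (by simp)) z τ).neg.congr_deriv
      (neg_neg _))
    (hu2.continuous.comp (continuous_dil_exp_neg z)) hτ₀pos
    (fun τ hτ => image_eq_zero_of_notMem_tsupport (hfar τ hτ))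
    (by
      have : eul u (dil (Real.exp (-τ₀)) z) = 0 := by
        by_contra h
        exact hfar τ₀ le_rfl (support_eul_subset u h)
      simp [this]) hlim
  rw [mul_div_assoc]
  convert key using 2
  · refine setLIntegral_congr_fun measurableSet_Ioi fun τ hτ => ?_
    rw [gNorm_dil (Real.exp_pos _).le, hz, div_mul_cancel_right₀ hR.ne', ← Real.exp_neg, neg_neg,
      Real.log_exp]
  · simp only [lapEul, mul_neg, sub_neg_eq_add]

lemma measurable_lapEul_rpow (Q p : ℝ) {u : GPt n → ℝ} (hu : ContDiff ℝ (⊤ : ℕ∞) u) :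
    Measurable fun z => |lapEul Q u z| ^ p :=
  (contDiff_lapEul Q hu).continuous.measurable.abs.pow_const p

lemma measurable_potential (R p : ℝ) {u : GPt n → ℝ} (hu : ContDiff ℝ (⊤ : ℕ∞) u) :
    Measurable fun z => |u z| ^ p / Real.log (R / gNorm z) ^ p :=
  (hu.continuous.measurable.abs.pow_const p).div
    ((Real.measurable_log.comp (continuous_gNorm.measurable.const_div R)).pow_const p)

/-- Polar form of the left-hand side. -/
lemma integral_rellich_eq {p R : ℝ} (hp : 1 < p) (hR : 0 < R) {u : GPt n → ℝ}
    (hu : ContDiff ℝ (⊤ : ℕ∞) u) :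
    ∫ z in {z : GPt n | gNorm z < R},
        |radialLap ((n : ℝ) + 2) u z| ^ p /
          (gPsi z ^ (p / 2) * gNorm z ^ ((n : ℝ) + 2 - 2 * p)) =
      (∫⁻ z in gShell n, angWeight p z * ∫⁻ τ in Set.Ioi (0 : ℝ),
        ENNReal.ofReal (|lapEul ((n : ℝ) + 2) u
          (dil (Real.exp (-τ)) (dil (R / gNorm z) z))| ^ p)).toReal := by
  simp_rw [rellich_integrand_eq hp hu]
  have hm := measurable_lapEul_rpow ((n : ℝ) + 2) p hu
  rw [integral_eq_lintegral_of_nonneg_ae]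
  · exact congrArg ENNReal.toReal (lintegral_ball_polar p hR hm)
  · refine ae_of_all _ fun z => ?_
    have := gNorm_nonneg z
    have := gPsi_nonneg z
    simp only [Pi.zero_apply]
    positivity
  · exact (((continuous_gNorm.measurable.pow_const _).mul
      (measurable_gPsi.pow_const _)).mul hm).aestronglyMeasurable

/-- Polar form of the right-hand side. -/
lemma integral_potential_eq {p R : ℝ} (hR : 0 < R) {u : GPt n → ℝ}
    (hu : ContDiff ℝ (⊤ : ℕ∞) u) :
    ∫ z in {z : GPt n | gNorm z < R},
        |u z| ^ p * gPsi z ^ (p / 2) / (gNorm z ^ ((n : ℝ) + 2) * Real.log (R / gNorm z) ^ p) =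
      (∫⁻ z in gShell n, angWeight p z * ∫⁻ τ in Set.Ioi (0 : ℝ),
        ENNReal.ofReal (|u (dil (Real.exp (-τ)) (dil (R / gNorm z) z))| ^ p /
          Real.log (R / gNorm (dil (Real.exp (-τ)) (dil (R / gNorm z) z))) ^ p)).toReal := by
  have h : ∀ z : GPt n,
      |u z| ^ p * gPsi z ^ (p / 2) / (gNorm z ^ ((n : ℝ) + 2) * Real.log (R / gNorm z) ^ p) =
      gNorm z ^ (-((n : ℝ) + 2)) * gPsi z ^ (p / 2) *
        (|u z| ^ p / Real.log (R / gNorm z) ^ p) := by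
    intro z
    rw [Real.rpow_neg (gNorm_nonneg z), div_eq_mul_inv, div_eq_mul_inv, mul_inv]
    ring
  simp_rw [h]
  have hm := measurable_potential R p hu
  rw [integral_eq_lintegral_of_nonneg_ae]
  · exact congrArg ENNReal.toReal (lintegral_ball_polar p hR hm)
  · refine (ae_restrict_iff' (measurableSet_lt continuous_gNorm.measurable measurable_const)).2
      (ae_of_all _ fun z hz => ?_)
    have hzR : gNorm z < R := hz
    have := gNorm_nonneg z
    have := gPsi_nonneg z
    have hlog : 0 ≤ Real.log (R / gNorm z) := by
      rcases this.eq_or_lt with h0 | h0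
      · rcases (gNorm_nonneg z).eq_or_lt with h1 | h1
        · simp [← h1]
        · exact Real.log_nonneg ((one_le_div h1).2 hzR.le)
      · rcases (gNorm_nonneg z).eq_or_lt with h1 | h1
        · simp [← h1]
        · exact Real.log_nonneg ((one_le_div h1).2 hzR.le)
    simp only [Pi.zero_apply]
    positivity
  · exact (((continuous_gNorm.measurable.pow_const _).mul
      (measurable_gPsi.pow_const _)).mul hm).aestronglyMeasurable

lemma gNorm_dil_div_gNorm {R : ℝ} (hR : 0 < R) {z : GPt n} (hz : z ∈ gShell n) :
    gNorm (dil (R / gNorm z) z) = R := by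
  have := gNorm_pos (ne_zero_of_mem_gShell hz)
  rw [gNorm_dil (div_pos hR this).le, div_mul_cancel₀ _ this.ne']

lemma lintegral_rellich_lt_top {p R : ℝ} (Q : ℝ) (hp : 1 < p) (hR : 0 < R) {u : GPt n → ℝ}
    (hu : IsTest {z : GPt n | gNorm z < R} u) :
    ∫⁻ z in gShell n, angWeight p z * ∫⁻ τ in Set.Ioi (0 : ℝ),
        ENNReal.ofReal (|lapEul Q u
          (dil (Real.exp (-τ)) (dil (R / gNorm z) z))| ^ p) < ⊤ := by
  obtain ⟨C, hC0, hC⟩ := exists_lapEul_bound Q R hu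
  set K : ENNReal :=
    ∫⁻ τ in Set.Ioi (0 : ℝ), ENNReal.ofReal ((C * R) ^ p * Real.exp (-p * τ)) with hK
  have hKtop : K < ⊤ := by
    have hint : IntegrableOn (fun τ : ℝ => (C * R) ^ p * Real.exp (-p * τ)) (Set.Ioi 0) :=
      (exp_neg_integrableOn_Ioi 0 (by linarith)).const_mul _
    rw [hK, ← ofReal_integral_eq_lintegral_ofReal hint (ae_of_all _ fun τ => by positivity)]
    exact ENNReal.ofReal_lt_top
  refine lt_of_le_of_lt (setLIntegral_mono' (g := fun z => angWeight p z * K)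
    measurableSet_gShell fun z hz => ?_) ?_
  · refine mul_le_mul_right (setLIntegral_mono' measurableSet_Ioi fun τ hτ => ?_) _
    refine ENNReal.ofReal_le_ofReal ?_
    have hg : gNorm (dil (Real.exp (-τ)) (dil (R / gNorm z) z)) = Real.exp (-τ) * R := by
      rw [gNorm_dil (Real.exp_pos _).le, gNorm_dil_div_gNorm hR hz]
    have h1 : Real.exp (-τ) ≤ 1 := Real.exp_le_one_iff.2 (by linarith [Set.mem_Ioi.1 hτ])
    have h2 := hC (dil (Real.exp (-τ)) (dil (R / gNorm z) z)) (by rw [hg]; nlinarith)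
    rw [hg] at h2
    refine (Real.rpow_le_rpow (abs_nonneg _) h2 (by linarith)).trans (le_of_eq ?_)
    rw [show C * (Real.exp (-τ) * R) = C * R * Real.exp (-τ) by ring,
      Real.mul_rpow (by positivity) (Real.exp_pos _).le, ← Real.exp_mul]
    ring_nf
  · rw [lintegral_mul_const _ (measurable_angWeight p)]
    exact ENNReal.mul_lt_top (lintegral_angWeight_lt_top (by linarith)) hKtop

lemma rellich_inequality (hn : 0 < n) {p R : ℝ} (hp : 1 < p) (hR : 0 < R) {u : GPt n → ℝ}
    (hu : IsTest {z : GPt n | gNorm z < R} u) :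
    (((n : ℝ) + 2 - 2) * (p - 1) / p) ^ p *
        ∫ z in {z : GPt n | gNorm z < R},
          |u z| ^ p * gPsi z ^ (p / 2) /
            (gNorm z ^ ((n : ℝ) + 2) * Real.log (R / gNorm z) ^ p) ≤
      ∫ z in {z : GPt n | gNorm z < R},
        |radialLap ((n : ℝ) + 2) u z| ^ p /
          (gPsi z ^ (p / 2) * gNorm z ^ ((n : ℝ) + 2 - 2 * p)) := by
  have hn' : (0 : ℝ) < n := Nat.cast_pos.2 hn
  set K := (((n : ℝ) + 2 - 2) * (p - 1) / p) ^ p with hKdef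
  have hK : 0 ≤ K :=
    Real.rpow_nonneg (div_nonneg (mul_nonneg (by linarith) (by linarith)) (by linarith)) _
  rw [integral_rellich_eq hp hR hu.1, integral_potential_eq hR hu.1]
  nth_rewrite 1 [← ENNReal.toReal_ofReal hK]
  rw [← ENNReal.toReal_mul]
  refine ENNReal.toReal_mono (lintegral_rellich_lt_top _ hp hR hu).ne ?_
  rw [← lintegral_const_mul' _ _ ENNReal.ofReal_ne_top]
  refine setLIntegral_mono' measurableSet_gShell fun z hz => ?_
  rw [mul_left_comm]
  exact mul_le_mul_right (lintegral_orbit_critical (by linarith) hp hR hu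
    (gNorm_dil_div_gNorm hR hz)) _

end Inequality

section Sharpness

open Filter Topology

variable {n : ℕ}

lemma contDiffAt_gNorm {z : GPt n} (hz : z ≠ 0) :
    ContDiffAt ℝ (⊤ : ℕ∞) (gNorm : GPt n → ℝ) z := by
  have hg := pow_pos (gNorm_pos hz) 4
  rw [gNorm_pow_four] at hg
  unfold gNorm
  refine ContDiffAt.rpow_const_of_ne ?_ hg.ne'
  have h1 : ContDiff ℝ (⊤ : ℕ∞) fun z : GPt n => ‖z.1‖ ^ 4 := by
    have h2 : (fun z : GPt n => ‖z.1‖ ^ 4) = fun z : GPt n => (‖z.1‖ ^ 2) ^ 2 := by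
      ext z; ring
    rw [h2]
    exact ((contDiff_norm_sq ℝ).comp contDiff_fst).pow 2
  exact (h1.add (contDiff_const.mul (contDiff_snd.pow 2))).contDiffAt

open Classical in
/-- The radial function with profile `f` in the variable `log (R / ϱ)`, cut off outside the
closed shell `α ≤ log (R / ϱ) ≤ β`. -/
def radialProfile (R α β : ℝ) (f : ℝ → ℝ) (z : GPt n) : ℝ :=
  if R * Real.exp (-β) ≤ gNorm z ∧ gNorm z ≤ R * Real.exp (-α) then
    f (Real.log (R / gNorm z)) else 0

lemma radialProfile_eq {R α β : ℝ} {f : ℝ → ℝ} (hR : 0 < R)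
    (hsupp : ∀ τ, 0 < τ → f τ ≠ 0 → α ≤ τ ∧ τ ≤ β) {z : GPt n} (h0 : 0 < gNorm z)
    (hz : gNorm z < R) : radialProfile R α β f z = f (Real.log (R / gNorm z)) := by
  unfold radialProfile
  split_ifs with h
  · rfl
  · by_contra hne
    refine h ?_
    obtain ⟨h1, h2⟩ := hsupp _ (Real.log_pos ((one_lt_div h0).2 hz)) (Ne.symm hne)
    rw [Real.le_log_iff_exp_le (by positivity)] at h1
    rw [Real.log_le_iff_le_exp (by positivity)] at h2
    rw [le_div_iff₀ h0] at h1
    rw [div_le_iff₀ h0] at h2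
    rw [Real.exp_neg, Real.exp_neg, ← div_eq_mul_inv, ← div_eq_mul_inv,
      div_le_iff₀ (Real.exp_pos _), le_div_iff₀ (Real.exp_pos _)]
    constructor <;> linarith

lemma isTest_radialProfile {R α β : ℝ} {f : ℝ → ℝ} (hR : 0 < R) (hα : 0 < α)
    (hf : ∀ τ, 0 < τ → ContDiffAt ℝ (⊤ : ℕ∞) f τ)
    (hsupp : ∀ τ, 0 < τ → f τ ≠ 0 → α ≤ τ ∧ τ ≤ β) :
    IsTest {z : GPt n | gNorm z < R} (radialProfile R α β f) := by
  set K : Set (GPt n) := {z | R * Real.exp (-β) ≤ gNorm z ∧ gNorm z ≤ R * Real.exp (-α)} with hK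
  have hKR : ∀ z ∈ K, 0 < gNorm z ∧ gNorm z < R := fun z hz =>
    ⟨(by positivity : 0 < R * Real.exp (-β)).trans_le hz.1,
      hz.2.trans_lt (mul_lt_of_lt_one_right hR (Real.exp_lt_one_iff.2 (by linarith)))⟩
  have hKclosed : IsClosed K :=
    (isClosed_le continuous_const continuous_gNorm).inter
      (isClosed_le continuous_gNorm continuous_const)
  have hKcomp : IsCompact K := by
    refine Metric.isCompact_of_isClosed_isBounded hKclosed ?_
    refine (Metric.isBounded_closedBall (x := (0 : GPt n)) (r := max R (R ^ 2))).subset ?_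
    intro z hz
    have hz' := (hKR z hz).2.le
    have h1 := norm_fst_le_gNorm z
    have h2 := two_mul_abs_snd_le_gNorm_sq z
    have h3 : gNorm z ^ 2 ≤ R ^ 2 := pow_le_pow_left₀ (gNorm_nonneg z) hz' 2
    rw [mem_closedBall_zero_iff, Prod.norm_def]
    refine max_le ((h1.trans hz').trans (le_max_left _ _)) (le_trans ?_ (le_max_right _ _))
    rw [Real.norm_eq_abs]
    linarith [abs_nonneg z.2]
  have hts : tsupport (radialProfile R α β f : GPt n → ℝ) ⊆ K := by
    refine closure_minimal (fun z hz => ?_) hKclosed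
    by_contra h
    exact hz (if_neg h)
  refine ⟨contDiff_iff_contDiffAt.2 fun z => ?_, hKcomp.of_isClosed_subset (isClosed_tsupport _) hts,
    hts.trans fun z hz => (hKR z hz).2⟩
  by_cases hz : z ∈ tsupport (radialProfile R α β f : GPt n → ℝ)
  · obtain ⟨h0, h1⟩ := hKR z (hts hz)
    have hz0 : z ≠ 0 := fun h => by rw [h, gNorm_zero] at h0; exact h0.false
    have hev : radialProfile R α β f =ᶠ[𝓝 z] fun z => f (Real.log (R / gNorm z)) := by
      filter_upwards [continuous_gNorm.continuousAt.eventually (lt_mem_nhds h0),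
        continuous_gNorm.continuousAt.eventually (gt_mem_nhds h1)] with y hy0 hy1
      exact radialProfile_eq hR hsupp hy0 hy1
    refine ContDiffAt.congr_of_eventuallyEq ?_ hev
    have hin : ContDiffAt ℝ (⊤ : ℕ∞) (fun z : GPt n => Real.log (R / gNorm z)) z :=
      (contDiffAt_const.div (contDiffAt_gNorm hz0) h0.ne').log (div_pos hR h0).ne'
    exact (hf _ (Real.log_pos ((one_lt_div h0).2 h1))).comp z hin
  · exact contDiffAt_const.congr_of_eventuallyEq (notMem_tsupport_iff_eventuallyEq.1 hz)

/-- A Rellich inequality on the ball implies its one-dimensional analogue. -/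
lemma one_dimensional_of_rellich (hn : 0 < n) {κ p R : ℝ} (hp : 1 < p) (hR : 0 < R)
    (hκ : ∀ u : GPt n → ℝ, IsTest {z : GPt n | gNorm z < R} u →
      κ * ∫ z in {z : GPt n | gNorm z < R},
          |u z| ^ p * gPsi z ^ (p / 2) /
            (gNorm z ^ ((n : ℝ) + 2) * Real.log (R / gNorm z) ^ p) ≤
        ∫ z in {z : GPt n | gNorm z < R},
          |radialLap ((n : ℝ) + 2) u z| ^ p /
            (gPsi z ^ (p / 2) * gNorm z ^ ((n : ℝ) + 2 - 2 * p)))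
    {α β : ℝ} {f f1 f2 : ℝ → ℝ} (hα : 0 < α)
    (hf : ∀ τ, 0 < τ → ContDiffAt ℝ (⊤ : ℕ∞) f τ)
    (hsupp : ∀ τ, 0 < τ → f τ ≠ 0 → α ≤ τ ∧ τ ≤ β)
    (h1 : ∀ τ, 0 < τ → HasDerivAt f (f1 τ) τ) (h2 : ∀ τ, 0 < τ → HasDerivAt f1 (f2 τ) τ) :
    κ * (∫⁻ τ in Set.Ioi (0 : ℝ), ENNReal.ofReal (|f τ| ^ p / τ ^ p)).toReal ≤
      (∫⁻ τ in Set.Ioi (0 : ℝ), ENNReal.ofReal (|f2 τ - n * f1 τ| ^ p)).toReal := by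
  set u : GPt n → ℝ := radialProfile R α β f with hu_def
  have hu : IsTest {z : GPt n | gNorm z < R} u := isTest_radialProfile hR hα hf hsupp
  have hu1 := contDiff_eul hu.1
  have hlogτ : ∀ z : GPt n, gNorm z = R → ∀ τ : ℝ,
      Real.log (R / gNorm (dil (Real.exp (-τ)) z)) = τ := by
    intro z hz τ
    rw [gNorm_dil (Real.exp_pos _).le, hz, div_mul_cancel_right₀ hR.ne', ← Real.exp_neg, neg_neg,
      Real.log_exp]
  have e0 : ∀ z : GPt n, gNorm z = R → ∀ τ : ℝ, 0 < τ → u (dil (Real.exp (-τ)) z) = f τ := by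
    intro z hz τ hτ
    have hg : gNorm (dil (Real.exp (-τ)) z) = Real.exp (-τ) * R := by
      rw [gNorm_dil (Real.exp_pos _).le, hz]
    rw [hu_def, radialProfile_eq hR hsupp (by rw [hg]; positivity)
      (by rw [hg]; exact mul_lt_of_lt_one_left hR (Real.exp_lt_one_iff.2 (by linarith))),
      hlogτ z hz]
  have e1 : ∀ z : GPt n, gNorm z = R → ∀ τ : ℝ, 0 < τ →
      eul u (dil (Real.exp (-τ)) z) = -f1 τ := by
    intro z hz τ hτ
    have d1 := hasDerivAt_comp_dil_exp_neg (hu.1.differentiable (by simp)) z τ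
    have d2 := (h1 τ hτ).congr_of_eventuallyEq (f₁ := fun r => u (dil (Real.exp (-r)) z)) (by
      filter_upwards [lt_mem_nhds hτ] with r hr using e0 z hz r hr)
    linarith [d1.unique d2]
  have e2 : ∀ z : GPt n, gNorm z = R → ∀ τ : ℝ, 0 < τ →
      eul (eul u) (dil (Real.exp (-τ)) z) = f2 τ := by
    intro z hz τ hτ
    have d1 := hasDerivAt_comp_dil_exp_neg (hu1.differentiable (by simp)) z τ
    have d2 := (h2 τ hτ).neg.congr_of_eventuallyEq
      (f₁ := fun r => eul u (dil (Real.exp (-r)) z)) (by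
        filter_upwards [lt_mem_nhds hτ] with r hr using e1 z hz r hr)
    linarith [d1.unique d2]
  have key := hκ u hu
  rw [integral_rellich_eq hp hR hu.1, integral_potential_eq hR hu.1] at key
  have hI1 : ∫⁻ z in gShell n, angWeight p z * ∫⁻ τ in Set.Ioi (0 : ℝ),
        ENNReal.ofReal (|lapEul ((n : ℝ) + 2) u
          (dil (Real.exp (-τ)) (dil (R / gNorm z) z))| ^ p) =
      (∫⁻ z in gShell n, angWeight p z) *
        ∫⁻ τ in Set.Ioi (0 : ℝ), ENNReal.ofReal (|f2 τ - n * f1 τ| ^ p) := by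
    rw [← lintegral_mul_const _ (measurable_angWeight p)]
    refine setLIntegral_congr_fun measurableSet_gShell fun z hz => ?_
    have hzR := gNorm_dil_div_gNorm hR hz
    refine congrArg _ (setLIntegral_congr_fun measurableSet_Ioi fun τ hτ => ?_)
    rw [lapEul, e1 _ hzR τ hτ, e2 _ hzR τ hτ]
    congr 3
    ring
  have hI2 : ∫⁻ z in gShell n, angWeight p z * ∫⁻ τ in Set.Ioi (0 : ℝ),
        ENNReal.ofReal (|u (dil (Real.exp (-τ)) (dil (R / gNorm z) z))| ^ p /
          Real.log (R / gNorm (dil (Real.exp (-τ)) (dil (R / gNorm z) z))) ^ p) =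
      (∫⁻ z in gShell n, angWeight p z) *
        ∫⁻ τ in Set.Ioi (0 : ℝ), ENNReal.ofReal (|f τ| ^ p / τ ^ p) := by
    rw [← lintegral_mul_const _ (measurable_angWeight p)]
    refine setLIntegral_congr_fun measurableSet_gShell fun z hz => ?_
    have hzR := gNorm_dil_div_gNorm hR hz
    refine congrArg _ (setLIntegral_congr_fun measurableSet_Ioi fun τ hτ => ?_)
    rw [hlogτ _ hzR, e0 _ hzR τ hτ]
  rw [hI1, hI2, ENNReal.toReal_mul, ENNReal.toReal_mul, mul_left_comm] at key
  exact le_of_mul_le_mul_left key (ENNReal.toReal_pos (lintegral_angWeight_pos hn p).ne'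
    (lintegral_angWeight_lt_top (by linarith)).ne)

lemma hasDerivAt_exp_log_mul {ψ ψ' : ℝ → ℝ} (hψ : ∀ x, HasDerivAt ψ (ψ' x) x) (b ε : ℝ) {τ : ℝ}
    (hτ : 0 < τ) :
    HasDerivAt (fun τ => Real.exp (b * Real.log τ) * ψ (ε * Real.log τ))
      (Real.exp ((b - 1) * Real.log τ) *
        (b * ψ (ε * Real.log τ) + ε * ψ' (ε * Real.log τ))) τ := by
  have hl := Real.hasDerivAt_log hτ.ne'
  have d1 := (hl.const_mul b).exp
  have d2 := (hψ (ε * Real.log τ)).comp τ (hl.const_mul ε)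
  refine (d1.mul d2).congr_deriv ?_
  have e : Real.exp ((b - 1) * Real.log τ) = Real.exp (b * Real.log τ) * τ⁻¹ := by
    rw [sub_mul, one_mul, Real.exp_sub, Real.exp_log hτ, div_eq_mul_inv]
  rw [e]
  simp only [Function.comp]
  ring

lemma lintegral_Ioi_eq_exp {ε : ℝ} (hε : 0 < ε) (g : ℝ → ENNReal) :
    ∫⁻ τ in Set.Ioi (0 : ℝ), g τ =
      ∫⁻ x : ℝ, ENNReal.ofReal (Real.exp (x / ε) / ε) * g (Real.exp (x / ε)) := by
  have himg : (fun x : ℝ => Real.exp (x / ε)) '' Set.univ = Set.Ioi 0 := by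
    rw [Set.image_univ]
    ext y
    constructor
    · rintro ⟨x, rfl⟩
      exact Real.exp_pos _
    · intro hy
      exact ⟨ε * Real.log y, by
        simp only
        rw [mul_div_cancel_left₀ _ hε.ne', Real.exp_log hy]⟩
  have hd : ∀ x ∈ (Set.univ : Set ℝ), HasDerivWithinAt (fun x : ℝ => Real.exp (x / ε))
      (Real.exp (x / ε) / ε) Set.univ x := fun x _ => by
    refine ((((hasDerivAt_id x).div_const ε).exp).congr_deriv ?_).hasDerivWithinAt
    simp [div_eq_mul_inv]
  have hinj : Set.InjOn (fun x : ℝ => Real.exp (x / ε)) Set.univ := fun x _ y _ h => by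
    have := Real.exp_injective h
    field_simp at this
    exact this
  rw [← himg, lintegral_image_eq_lintegral_abs_deriv_mul MeasurableSet.univ hd hinj,
    Measure.restrict_univ]
  refine lintegral_congr fun x => ?_
  rw [abs_of_pos (by positivity)]

lemma exp_mul_rpow_scaling {p ε x c b : ℝ} (hc : c * p = p - 1) (hb : 0 ≤ b) :
    Real.exp (x / ε) / ε * ((Real.exp ((c - 1) * (x / ε)) * b) ^ p) = ε⁻¹ * b ^ p := by
  rw [Real.mul_rpow (Real.exp_pos _).le hb, ← Real.exp_mul, div_mul_eq_mul_div, ← mul_assoc,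
    ← Real.exp_add]
  have : x / ε + (c - 1) * (x / ε) * p = (x / ε) * (1 + c * p - p) := by ring
  rw [this, hc]
  simp [div_eq_inv_mul]

/-- The rescaled one-dimensional inequality tested on `τ ^ c φ (ε log τ)`. -/
lemma bump_inequality (hn : 0 < n) {κ p R : ℝ} (hp : 1 < p) (hR : 0 < R)
    (hκ : ∀ u : GPt n → ℝ, IsTest {z : GPt n | gNorm z < R} u →
      κ * ∫ z in {z : GPt n | gNorm z < R},
          |u z| ^ p * gPsi z ^ (p / 2) /
            (gNorm z ^ ((n : ℝ) + 2) * Real.log (R / gNorm z) ^ p) ≤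
        ∫ z in {z : GPt n | gNorm z < R},
          |radialLap ((n : ℝ) + 2) u z| ^ p /
            (gPsi z ^ (p / 2) * gNorm z ^ ((n : ℝ) + 2 - 2 * p)))
    {φ φ1 φ2 : ℝ → ℝ} (hφ : ContDiff ℝ (⊤ : ℕ∞) φ) (hsupp : ∀ x, φ x ≠ 0 → 1 ≤ x ∧ x ≤ 2)
    (h1 : ∀ x, HasDerivAt φ (φ1 x) x) (h2 : ∀ x, HasDerivAt φ1 (φ2 x) x) (hφ2 : Continuous φ2)
    {c ε : ℝ} (hc : c * p = p - 1) (hε : 0 < ε) :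
    κ * ∫ x, |φ x| ^ p ≤
      ∫ x, |Real.exp (-(x / ε)) *
          ((c - 1) * (c * φ x + ε * φ1 x) + ε * (c * φ1 x + ε * φ2 x)) -
        n * (c * φ x + ε * φ1 x)| ^ p := by
  have hφc : Continuous φ := hφ.continuous
  have hφ1c : Continuous φ1 := continuous_iff_continuousAt.2 fun τ => (h2 τ).continuousAt
  have hp0 : 0 ≤ p := by linarith
  set ψ : ℝ → ℝ := fun x => c * φ x + ε * φ1 x with hψ
  set ψ1 : ℝ → ℝ := fun x => c * φ1 x + ε * φ2 x with hψ1
  have hψd : ∀ x, HasDerivAt ψ (ψ1 x) x := fun x => ((h1 x).const_mul c).add ((h2 x).const_mul ε)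
  have key := one_dimensional_of_rellich hn hp hR hκ
    (α := Real.exp (1 / ε)) (β := Real.exp (2 / ε))
    (f := fun τ => Real.exp (c * Real.log τ) * φ (ε * Real.log τ))
    (f1 := fun τ => Real.exp ((c - 1) * Real.log τ) * ψ (ε * Real.log τ))
    (f2 := fun τ => Real.exp ((c - 1 - 1) * Real.log τ) *
      ((c - 1) * ψ (ε * Real.log τ) + ε * ψ1 (ε * Real.log τ)))
    (Real.exp_pos _)
    (fun τ hτ => by
      have hl : ContDiffAt ℝ (⊤ : ℕ∞) Real.log τ := Real.contDiffAt_log.2 hτ.ne'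
      exact (contDiffAt_const.mul hl).exp.mul
        (hφ.contDiffAt.comp τ (contDiffAt_const.mul hl)))
    (fun τ hτ hne => by
      obtain ⟨ha, hb⟩ := hsupp _ (right_ne_zero_of_mul hne)
      rw [← Real.le_log_iff_exp_le hτ, ← Real.log_le_iff_le_exp hτ, div_le_iff₀ hε,
        le_div_iff₀ hε]
      constructor <;> linarith)
    (fun τ hτ => hasDerivAt_exp_log_mul h1 c ε hτ)
    (fun τ hτ => hasDerivAt_exp_log_mul hψd (c - 1) ε hτ)
  rw [lintegral_Ioi_eq_exp hε, lintegral_Ioi_eq_exp hε] at key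
  have hεx : ∀ x, ε * (x / ε) = x := fun x => mul_div_cancel₀ x hε.ne'
  have i1 : ∀ x : ℝ, ENNReal.ofReal (Real.exp (x / ε) / ε) *
      ENNReal.ofReal (|Real.exp (c * Real.log (Real.exp (x / ε))) *
        φ (ε * Real.log (Real.exp (x / ε)))| ^ p / Real.exp (x / ε) ^ p) =
      ENNReal.ofReal (ε⁻¹ * |φ x| ^ p) := by
    intro x
    rw [← ENNReal.ofReal_mul (by positivity), Real.log_exp, hεx,
      ← exp_mul_rpow_scaling (x := x) (ε := ε) hc (abs_nonneg _), abs_mul, Real.abs_exp,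
      ← Real.div_rpow (by positivity) (by positivity), mul_div_right_comm, ← Real.exp_sub]
    ring_nf
  have i2 : ∀ x : ℝ, ENNReal.ofReal (Real.exp (x / ε) / ε) *
      ENNReal.ofReal (|Real.exp ((c - 1 - 1) * Real.log (Real.exp (x / ε))) *
        ((c - 1) * ψ (ε * Real.log (Real.exp (x / ε))) +
          ε * ψ1 (ε * Real.log (Real.exp (x / ε)))) -
        n * (Real.exp ((c - 1) * Real.log (Real.exp (x / ε))) *
          ψ (ε * Real.log (Real.exp (x / ε))))| ^ p) =
      ENNReal.ofReal (ε⁻¹ * |Real.exp (-(x / ε)) * ((c - 1) * ψ x + ε * ψ1 x) - n * ψ x| ^ p) := by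
    intro x
    rw [← ENNReal.ofReal_mul (by positivity), Real.log_exp, hεx,
      ← exp_mul_rpow_scaling (x := x) (ε := ε) hc (abs_nonneg _)]
    congr 3
    conv_rhs => rw [← Real.abs_exp ((c - 1) * (x / ε)), ← abs_mul]
    congr 1
    have : Real.exp ((c - 1 - 1) * (x / ε)) =
        Real.exp ((c - 1) * (x / ε)) * Real.exp (-(x / ε)) := by
      rw [← Real.exp_add]; ring_nf
    rw [this]
    ring
  rw [lintegral_congr i1, lintegral_congr i2, ← integral_eq_lintegral_of_nonneg_ae,
    ← integral_eq_lintegral_of_nonneg_ae, integral_const_mul, integral_const_mul,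
    mul_left_comm] at key
  · exact le_of_mul_le_mul_left key (inv_pos.2 hε)
  · exact ae_of_all _ fun x => by simp only [Pi.zero_apply]; positivity
  · have hψc : Continuous ψ := (hφc.const_mul c).add (hφ1c.const_mul ε)
    have hψ1c : Continuous ψ1 := (hφ1c.const_mul c).add (hφ2.const_mul ε)
    refine Continuous.aestronglyMeasurable (continuous_const.mul
      (Continuous.rpow_const (Continuous.abs ?_) fun _ => Or.inr hp0))
    fun_prop
  · exact ae_of_all _ fun x => by simp only [Pi.zero_apply]; positivity
  · exact (continuous_const.mul (hφc.abs.rpow_const fun _ => Or.inr hp0)).aestronglyMeasurable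

lemma tendsto_bump_integral {p a c : ℝ} (hp : 1 < p) {φ φ1 φ2 : ℝ → ℝ}
    (hφ : Continuous φ) (hφ1 : Continuous φ1) (hφ2 : Continuous φ2)
    (s0 : ∀ x, φ x ≠ 0 → 1 ≤ x ∧ x ≤ 2) (s1 : ∀ x, φ1 x ≠ 0 → 1 ≤ x ∧ x ≤ 2)
    (s2 : ∀ x, φ2 x ≠ 0 → 1 ≤ x ∧ x ≤ 2) :
    Tendsto (fun ε : ℝ => ∫ x, |Real.exp (-(x / ε)) *
          ((c - 1) * (c * φ x + ε * φ1 x) + ε * (c * φ1 x + ε * φ2 x)) -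
        a * (c * φ x + ε * φ1 x)| ^ p) (𝓝[>] 0) (𝓝 (∫ x, |a * (c * φ x)| ^ p)) := by
  have hp0 : 0 ≤ p := by linarith
  have bdd : ∀ g : ℝ → ℝ, Continuous g → (∀ x, g x ≠ 0 → 1 ≤ x ∧ x ≤ 2) →
      ∃ M, ∀ x, |g x| ≤ M := fun g hg hs =>
    (HasCompactSupport.intro isCompact_Icc fun x hx => by
      by_contra h
      exact hx (hs x h) : HasCompactSupport g).exists_bound_of_continuous hg
  obtain ⟨M0, hM0⟩ := bdd φ hφ s0
  obtain ⟨M1, hM1⟩ := bdd φ1 hφ1 s1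
  obtain ⟨M2, hM2⟩ := bdd φ2 hφ2 s2
  set B := |c - 1| * (|c| * M0 + M1) + (|c| * M1 + M2) + |a| * (|c| * M0 + M1) with hB
  have hM0' : 0 ≤ M0 := (abs_nonneg _).trans (hM0 0)
  have hM1' : 0 ≤ M1 := (abs_nonneg _).trans (hM1 0)
  have hM2' : 0 ≤ M2 := (abs_nonneg _).trans (hM2 0)
  have hε1 : ∀ᶠ ε : ℝ in 𝓝[>] 0, 0 < ε ∧ ε < 1 :=
    Ioo_mem_nhdsGT (zero_lt_one' ℝ)
  refine tendsto_integral_filter_of_dominated_convergence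
    ((Set.Icc (1 : ℝ) 2).indicator fun _ => B ^ p) ?_ ?_ ?_ ?_
  · refine Eventually.of_forall fun ε => Continuous.aestronglyMeasurable
      (Continuous.rpow_const (Continuous.abs ?_) fun _ => Or.inr hp0)
    fun_prop
  · filter_upwards [hε1] with ε hε
    refine ae_of_all _ fun x => ?_
    by_cases hx : x ∈ Set.Icc (1 : ℝ) 2
    · rw [Set.indicator_of_mem hx, Real.norm_eq_abs, abs_of_nonneg (by positivity)]
      refine Real.rpow_le_rpow (abs_nonneg _) ?_ hp0
      have hx0 : 0 ≤ x := by linarith [hx.1]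
      have hexp : Real.exp (-(x / ε)) ≤ 1 :=
        Real.exp_le_one_iff.2 (neg_nonpos.2 (div_nonneg hx0 hε.1.le))
      have hmul : ∀ y, |ε * y| ≤ |y| := fun y => by
        rw [abs_mul, abs_of_pos hε.1]
        exact mul_le_of_le_one_left (abs_nonneg _) hε.2.le
      have b1 : |c * φ x + ε * φ1 x| ≤ |c| * M0 + M1 := by
        refine (abs_add_le _ _).trans (add_le_add ?_ ((hmul _).trans (hM1 x)))
        rw [abs_mul]
        exact mul_le_mul_of_nonneg_left (hM0 x) (abs_nonneg c)
      have b2 : |c * φ1 x + ε * φ2 x| ≤ |c| * M1 + M2 := by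
        refine (abs_add_le _ _).trans (add_le_add ?_ ((hmul _).trans (hM2 x)))
        rw [abs_mul]
        exact mul_le_mul_of_nonneg_left (hM1 x) (abs_nonneg c)
      refine (abs_sub _ _).trans (add_le_add ?_ ?_)
      · rw [abs_mul, Real.abs_exp]
        refine (mul_le_of_le_one_left (abs_nonneg _) hexp).trans ?_
        refine (abs_add_le _ _).trans (add_le_add ?_ ((hmul _).trans b2))
        rw [abs_mul]
        exact mul_le_mul_of_nonneg_left b1 (abs_nonneg _)
      · rw [abs_mul]
        exact mul_le_mul_of_nonneg_left b1 (abs_nonneg _)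
    · have z0 : φ x = 0 := by by_contra h; exact hx (s0 x h)
      have z1 : φ1 x = 0 := by by_contra h; exact hx (s1 x h)
      have z2 : φ2 x = 0 := by by_contra h; exact hx (s2 x h)
      simp [Set.indicator_of_notMem hx, z0, z1, z2, Real.zero_rpow (by linarith : p ≠ 0)]
  · exact (integrable_indicator_iff measurableSet_Icc).2 (integrableOn_const (by simp))
  · refine ae_of_all _ fun x => ?_
    by_cases hx : x ∈ Set.Icc (1 : ℝ) 2
    · have hx0 : 0 < x := by linarith [hx.1]
      have hid : Tendsto (fun ε : ℝ => ε) (𝓝[>] 0) (𝓝 0) := tendsto_nhdsWithin_of_tendsto_nhds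
        tendsto_id
      have hexp : Tendsto (fun ε : ℝ => Real.exp (-(x / ε))) (𝓝[>] 0) (𝓝 0) := by
        have h : Tendsto (fun ε : ℝ => x / ε) (𝓝[>] 0) atTop := by
          simp_rw [div_eq_mul_inv]
          exact tendsto_inv_nhdsGT_zero.const_mul_atTop hx0
        exact Real.tendsto_exp_neg_atTop_nhds_zero.comp h
      have t1 : Tendsto (fun ε : ℝ => c * φ x + ε * φ1 x) (𝓝[>] 0) (𝓝 (c * φ x + 0 * φ1 x)) :=
        tendsto_const_nhds.add (hid.mul_const _)
      have t2 : Tendsto (fun ε : ℝ => c * φ1 x + ε * φ2 x) (𝓝[>] 0)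
          (𝓝 (c * φ1 x + 0 * φ2 x)) :=
        tendsto_const_nhds.add (hid.mul_const _)
      have t3 := ((hexp.mul ((t1.const_mul (c - 1)).add (hid.mul t2))).sub
        (t1.const_mul a)).abs.rpow_const (p := p) (Or.inr hp0)
      simpa using t3
    · have z0 : φ x = 0 := by by_contra h; exact hx (s0 x h)
      have z1 : φ1 x = 0 := by by_contra h; exact hx (s1 x h)
      have z2 : φ2 x = 0 := by by_contra h; exact hx (s2 x h)
      simp [z0, z1, z2]

lemma rellich_constant_le (hn : 0 < n) {κ p R : ℝ} (hp : 1 < p) (hR : 0 < R)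
    (hκ : ∀ u : GPt n → ℝ, IsTest {z : GPt n | gNorm z < R} u →
      κ * ∫ z in {z : GPt n | gNorm z < R},
          |u z| ^ p * gPsi z ^ (p / 2) /
            (gNorm z ^ ((n : ℝ) + 2) * Real.log (R / gNorm z) ^ p) ≤
        ∫ z in {z : GPt n | gNorm z < R},
          |radialLap ((n : ℝ) + 2) u z| ^ p /
            (gPsi z ^ (p / 2) * gNorm z ^ ((n : ℝ) + 2 - 2 * p))) :
    κ ≤ (((n : ℝ) + 2 - 2) * (p - 1) / p) ^ p := by
  have hp0 : 0 < p := by linarith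
  let b : ContDiffBump (3 / 2 : ℝ) := ⟨1 / 4, 1 / 2, by norm_num, by norm_num⟩
  set φ : ℝ → ℝ := fun x => b x with hφdef
  have hφ : ContDiff ℝ (⊤ : ℕ∞) φ := b.contDiff
  have hφ' : ContDiff ℝ (⊤ : ℕ∞) (deriv φ) := (contDiff_infty_iff_deriv.1 hφ).2
  have hφ'' : ContDiff ℝ (⊤ : ℕ∞) (deriv (deriv φ)) := (contDiff_infty_iff_deriv.1 hφ').2
  have hIcc : tsupport φ ⊆ Set.Icc 1 2 := by
    rw [hφdef, b.tsupport_eq, Real.closedBall_eq_Icc]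
    refine Set.Icc_subset_Icc ?_ ?_ <;> norm_num [b]
  have s1 : Function.support (deriv φ) ⊆ tsupport φ := support_deriv_subset
  have s2 : Function.support (deriv (deriv φ)) ⊆ tsupport φ :=
    support_deriv_subset.trans (closure_minimal s1 (isClosed_tsupport φ))
  set c := (p - 1) / p with hc
  have hcp : c * p = p - 1 := div_mul_cancel₀ _ hp0.ne'
  have hlim := tendsto_bump_integral (a := n) (c := c) hp hφ.continuous hφ'.continuous
    hφ''.continuous (fun x hx => hIcc (subset_tsupport _ hx)) (fun x hx => hIcc (s1 hx))
    (fun x hx => hIcc (s2 hx))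
  have hle : κ * ∫ x, |φ x| ^ p ≤ ∫ x, |(n : ℝ) * (c * φ x)| ^ p := by
    refine ge_of_tendsto hlim ?_
    filter_upwards [self_mem_nhdsWithin] with ε hε
    exact bump_inequality hn hp hR hκ hφ (fun x hx => hIcc (subset_tsupport _ hx))
      (fun x => (hφ.differentiable (by simp) x).hasDerivAt)
      (fun x => (hφ'.differentiable (by simp) x).hasDerivAt) hφ''.continuous hcp hε
  have hc0 : 0 ≤ c := div_nonneg (by linarith) hp0.le
  have hn0 : (0 : ℝ) ≤ n := Nat.cast_nonneg n
  have hfac : ∀ x, |(n : ℝ) * (c * φ x)| ^ p = (((n : ℝ) + 2 - 2) * (p - 1) / p) ^ p * |φ x| ^ p := by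
    intro x
    rw [← mul_assoc, abs_mul, abs_of_nonneg (mul_nonneg hn0 hc0),
      Real.mul_rpow (mul_nonneg hn0 hc0) (abs_nonneg _), add_sub_cancel_right, mul_div_assoc]
  simp_rw [hfac] at hle
  rw [integral_const_mul] at hle
  refine le_of_mul_le_mul_right hle ?_
  have hcont : Continuous fun x => |φ x| ^ p :=
    hφ.continuous.abs.rpow_const fun _ => Or.inr hp0.le
  have hcs : HasCompactSupport fun x => |φ x| ^ p :=
    b.hasCompactSupport.comp_left (g := fun y : ℝ => |y| ^ p)
      (by simp [Real.zero_rpow hp0.ne'])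
  refine hcont.integral_pos_of_hasCompactSupport_nonneg_nonzero hcs (fun x => by positivity)
    (x := 3 / 2) ?_
  have : φ (3 / 2) = 1 := b.one_of_mem_closedBall (Metric.mem_closedBall_self b.rIn_pos.le)
  simp [this]

end Sharpness

/-- critical Rellich inequality on the gauge ball, with best constant
`((Q−2)(p−1)/p)^p` (Theorem 4.4 of the paper). -/
theorem critical_rellich
    (n : ℕ) (Q : ℝ) (hQ : Q = n + 2) (hQ4 : 4 ≤ Q) (R : ℝ) (hR : 0 < R)
    (p : ℝ) (hp : 1 < p) (hpQ : p < Q) :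
    (∀ u : GPt n → ℝ, IsTest {z : GPt n | gNorm z < R} u →
      (∫ z in {z : GPt n | gNorm z < R},
          |radialLap Q u z| ^ p / (gPsi z ^ (p / 2) * gNorm z ^ (Q - 2 * p)))
        ≥ ((Q - 2) * (p - 1) / p) ^ p *
            ∫ z in {z : GPt n | gNorm z < R},
              |u z| ^ p * gPsi z ^ (p / 2) /
                (gNorm z ^ Q * Real.log (R / gNorm z) ^ p))
    ∧ ∀ κ : ℝ,
        (∀ u : GPt n → ℝ, IsTest {z : GPt n | gNorm z < R} u →
          (∫ z in {z : GPt n | gNorm z < R},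
              |radialLap Q u z| ^ p / (gPsi z ^ (p / 2) * gNorm z ^ (Q - 2 * p)))
            ≥ κ *
                ∫ z in {z : GPt n | gNorm z < R},
                  |u z| ^ p * gPsi z ^ (p / 2) /
                    (gNorm z ^ Q * Real.log (R / gNorm z) ^ p)) →
        κ ≤ ((Q - 2) * (p - 1) / p) ^ p := by
  subst hQ
  have hn : 0 < n := by
    have : (0 : ℝ) < n := by linarith
    exact_mod_cast this
  exact ⟨fun u hu => rellich_inequality hn hp hR hu,
    fun κ hκ => rellich_constant_le hn hp hR hκ⟩
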